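/- Let (R, 𝔪) be a two-dimensional regular local ring with infinite residue field and let I be an integrally closed 𝔪-primary ideal with ord(I) = n. Then I = I(M) for an indecomposable integrally closed R-module M of rank 3 if and only if one of the following holds: (1) n > 3; (2) n = 3 and there do not exist 𝔪-primary integrally closed ideals J and K of orders 1 and 2 respectively such that I = JK and both (a) λ(R/JK) = λ(R/J) + λ(R/K) + 2 and (b) 𝔪^2 = 𝔪J + K hold. -/

import Mathlib

open IsLocalRing

section Defs

variable {R : Type*} [CommRing R]

/-- `R` is a two-dimensional regular local ring: Noetherian local of Krull dimension 2
whose maximal ideal is generated by two elements. -/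
def IsTwoDimRegularLocal (R : Type*) [CommRing R] [IsLocalRing R] : Prop :=
  IsNoetherianRing R ∧ ringKrullDim R = 2 ∧
    ∃ x y : R, maximalIdeal R = Ideal.span {x, y}

/-- `z` lies in the integral closure of the ideal `I`, i.e. it satisfies an equation
`z ^ n + c 1 * z ^ (n-1) + ⋯ + c n = 0` with `c i ∈ I ^ i`. -/
def MemIntClosure (I : Ideal R) (z : R) : Prop :=
  ∃ n : ℕ, 0 < n ∧ ∃ c : ℕ → R, (∀ i ∈ Finset.Icc 1 n, c i ∈ I ^ i) ∧
    z ^ n + ∑ i ∈ Finset.Icc 1 n, c i * z ^ (n - i) = 0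

/-- The ideal `I` is integrally closed. -/
def IdealIntClosed (I : Ideal R) : Prop := ∀ z, MemIntClosure I z → z ∈ I

/-- `I` is `𝔪`-primary. -/
def IsMPrimary [IsLocalRing R] (I : Ideal R) : Prop := I.radical = maximalIdeal R

/-- `ord I = n` : `n` is the largest power of the maximal ideal containing `I`. -/
def ordEQ [IsLocalRing R] (I : Ideal R) (n : ℕ) : Prop :=
  I ≤ maximalIdeal R ^ n ∧ ¬ I ≤ maximalIdeal R ^ (n + 1)

/-- Determinant of the square matrix with columns `w 0, …, w (r-1)`. -/
def colDet {r : ℕ} (w : Fin r → Fin r → R) : R :=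
  Matrix.det (Matrix.of fun i j => w j i)

/-- The ideal of maximal minors `I(M)` of a submodule `M ⊆ R^r`:  it is generated by all
determinants of `r × r` matrices whose columns lie in `M`. -/
def maxMinors {r : ℕ} (M : Submodule R (Fin r → R)) : Ideal R :=
  Ideal.span { d | ∃ w : Fin r → Fin r → R, (∀ j, w j ∈ M) ∧ d = colDet w }

/-- The ideal `I_k(M)` of `k × k` minors of a matrix whose columns generate `M ⊆ R^r`. -/
def minorsIdeal (k : ℕ) {r : ℕ} (M : Submodule R (Fin r → R)) : Ideal R :=
  Ideal.span { d | ∃ (w : Fin k → Fin r → R) (ρ : Fin k → Fin r),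
    Function.Injective ρ ∧ (∀ j, w j ∈ M) ∧
    d = Matrix.det (Matrix.of fun i j : Fin k => w j (ρ i)) }

/-- `v ∈ R^r` is integral over the submodule `M ⊆ R^r` : the determinant of every square
matrix with one column `v` and the remaining columns in `M` is integral over `I(M)`. -/
def IntegralOverMod {r : ℕ} (M : Submodule R (Fin r → R)) (v : Fin r → R) : Prop :=
  ∀ (w : Fin r → Fin r → R) (j₀ : Fin r), w j₀ = v → (∀ j, j ≠ j₀ → w j ∈ M) →
    MemIntClosure (maxMinors M) (colDet w)

/-- The submodule `M ⊆ R^r` is integrally closed. -/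
def ModIntClosed {r : ℕ} (M : Submodule R (Fin r → R)) : Prop :=
  ∀ v, IntegralOverMod M v → v ∈ M

/-- The length of an `R`-module, as the Krull dimension of its submodule lattice. -/
noncomputable def modLength (R : Type*) (M : Type*) [CommRing R] [AddCommGroup M]
    [Module R M] : WithBot ℕ∞ :=
  Order.krullDim (Submodule R M)

/-- `M ⊆ R^r` has finite colength; equivalently, `M` is a finitely generated torsion-free
module of rank `r` with double dual `M** = R^r`. -/
def FinColength {r : ℕ} (M : Submodule R (Fin r → R)) : Prop :=
  IsFiniteLength R ((Fin r → R) ⧸ M)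

/-- `M` has a nonzero free direct summand. -/
def HasFreeSummand {r : ℕ} (M : Submodule R (Fin r → R)) : Prop :=
  ∃ N P : Submodule R (Fin r → R), N ⊔ P = M ∧ N ⊓ P = ⊥ ∧ N ≠ ⊥ ∧ Module.Free R ↥N

/-- `M` is a direct sum of two nonzero submodules. -/
def DecomposableSub {r : ℕ} (M : Submodule R (Fin r → R)) : Prop :=
  ∃ N P : Submodule R (Fin r → R), N ⊔ P = M ∧ N ⊓ P = ⊥ ∧ N ≠ ⊥ ∧ P ≠ ⊥

/-- `M` is nonzero and not a direct sum of two nonzero submodules. -/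
def IndecomposableSub {r : ℕ} (M : Submodule R (Fin r → R)) : Prop :=
  M ≠ ⊥ ∧ ¬ DecomposableSub M

/-- `a` is a minimal generating set of the ideal `I`. -/
def MinGens {m : ℕ} (I : Ideal R) (a : Fin m → R) : Prop :=
  Ideal.span (Set.range a) = I ∧ ∀ j : Fin m, Ideal.span (a '' {j}ᶜ) ≠ I

/-- `a = c 0 * x^(r-1) + c 1 * x^(r-2) * y + ⋯ + c (r-1) * y^(r-1)`. -/
def Expresses (r : ℕ) (x y : R) (c : Fin r → R) (a : R) : Prop :=
  a = ∑ i : Fin r, c i * x ^ (r - 1 - (i : ℕ)) * y ^ (i : ℕ)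

/-- The `k`-th Koszul relation column between `x^(r-1), …, y^(r-1)`:
`y` in position `k` and `-x` in position `k+1`. -/
def stdRelCol (r : ℕ) (x y : R) (k : ℕ) : Fin r → R :=
  fun i => if (i : ℕ) = k then y else if (i : ℕ) = k + 1 then -x else 0

/-- The module generated by the coefficient columns `C j` together with the `r - 1`
Koszul relation columns between `x^(r-1), …, y^(r-1)`. -/
def MrSpan (r : ℕ) (x y : R) {m : ℕ} (C : Fin m → Fin r → R) :
    Submodule R (Fin r → R) :=
  Submodule.span R (Set.range C ∪ { v | ∃ k, k < r - 1 ∧ v = stdRelCol r x y k })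

/-- The data `(x, y, a, C)` presents the module `M_r(I)` : `𝔪 = (x,y)`, `a` is a minimal
generating set of `I` and column `C j` expresses `a j` in terms of `x^(r-1), …, y^(r-1)`. -/
def IsMrPresentation [IsLocalRing R] (r : ℕ) (I : Ideal R) {m : ℕ} (x y : R)
    (a : Fin m → R) (C : Fin m → Fin r → R) : Prop :=
  maximalIdeal R = Ideal.span {x, y} ∧ MinGens I a ∧ ∀ j, Expresses r x y (C j) (a j)

/-- `N` is a reduction of `M` : `N ≤ M` and every element of `M` is integral over `N`. -/
def IsReductionMod {r : ℕ} (N M : Submodule R (Fin r → R)) : Prop :=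
  N ≤ M ∧ ∀ v ∈ M, IntegralOverMod N v

/-- `N` is a minimal reduction of `M`. -/
def IsMinimalReductionMod {r : ℕ} (N M : Submodule R (Fin r → R)) : Prop :=
  IsReductionMod N M ∧ ∀ N' ≤ N, IsReductionMod N' M → N' = N

/-- The `j`-th signed maximal minor of an `r × (r+1)` matrix. -/
def signedMinor {r : ℕ} (A : Matrix (Fin r) (Fin (r + 1)) R) (j : Fin (r + 1)) : R :=
  (-1 : R) ^ (j : ℕ) * (A.submatrix id j.succAbove).det

/-- `M ⊆ R^r` is extremal: integrally closed, without free direct summands, with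
`λ(R/I(M)) = λ(R^r/M) + r(r-1)/2`. -/
def IsExtremal {r : ℕ} (M : Submodule R (Fin r → R)) : Prop :=
  FinColength M ∧ ModIntClosed M ∧ ¬ HasFreeSummand M ∧
    modLength R (R ⧸ maxMinors M) =
      modLength R ((Fin r → R) ⧸ M) + ((r * (r - 1) / 2 : ℕ) : WithBot ℕ∞)

/-- `a ∈ J`, `b ∈ K` is a joint reduction of the pair `(J, K)`. -/
def IsJointReduction (J K : Ideal R) (a b : R) : Prop :=
  a ∈ J ∧ b ∈ K ∧ ∃ n : ℕ,
    (Ideal.span {a} * K + Ideal.span {b} * J) * (J * K) ^ n = (J * K) ^ (n + 1)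

/-- `S` is the matrix `Sym^k(Q)` for `Q = [[a, c], [b, d]]` : with `X = aU + bV`,
`Y = cU + dV`, the `j`-th column of `S` records the coefficients of
`X^(k-j) Y^j` in terms of `U^k, U^(k-1)V, …, V^k`. -/
def IsSymOf (k : ℕ) (a b c d : R) (S : Matrix (Fin (k + 1)) (Fin (k + 1)) R) : Prop :=
  ∀ j : Fin (k + 1),
    ((MvPolynomial.C a * MvPolynomial.X 0 + MvPolynomial.C b * MvPolynomial.X 1) ^ (k - (j : ℕ)) *
        (MvPolynomial.C c * MvPolynomial.X 0 + MvPolynomial.C d * MvPolynomial.X 1) ^ (j : ℕ)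
      : MvPolynomial (Fin 2) R)
    = ∑ i : Fin (k + 1), MvPolynomial.C (S i j) *
        MvPolynomial.X 0 ^ (k - (i : ℕ)) * MvPolynomial.X 1 ^ (i : ℕ)

/-- The `r × s` bidiagonal matrix with `y` on the diagonal and `-x` directly below it. -/
def bidiag (r s : ℕ) (x y : R) : Matrix (Fin r) (Fin s) R :=
  Matrix.of fun i j =>
    if (i : ℕ) = (j : ℕ) then y else if (i : ℕ) = (j : ℕ) + 1 then -x else 0

end Defs

section RegularLocal

variable {R : Type*} [CommRing R]

lemma sup_pow_le_sup_pow (A B : Ideal R) (j : ℕ) : (A ⊔ B) ^ j ≤ A ⊔ B ^ j := by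
  induction j with
  | zero => simp
  | succ j ih =>
    rw [pow_succ, pow_succ]
    have h1 : (A ⊔ B) ^ j * (A ⊔ B) ≤ (A ⊔ B ^ j) * (A ⊔ B) := Ideal.mul_mono ih le_rfl
    have h2 : (A ⊔ B ^ j) * (A ⊔ B) = A * (A ⊔ B) ⊔ (B ^ j * A ⊔ B ^ j * B) := by
      rw [Ideal.sup_mul, Ideal.mul_sup (B ^ j)]
    rw [h2] at h1
    refine h1.trans (sup_le ?_ (sup_le ?_ le_sup_right))
    · exact le_trans (b := A) Ideal.mul_le_left le_sup_left
    · exact le_trans (b := A) Ideal.mul_le_right le_sup_left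

variable [IsLocalRing R]

lemma isUnit_of_notMem_maximalIdeal {z : R} (h : z ∉ maximalIdeal R) : IsUnit z := by
  simpa using h

lemma notMem_maximalIdeal_of_isUnit {z : R} (h : IsUnit z) : z ∉ maximalIdeal R := by
  simpa using h

lemma left_mem_maximalIdeal {a b : R} (h : maximalIdeal R = Ideal.span {a, b}) :
    a ∈ maximalIdeal R := by
  rw [h]; exact Ideal.subset_span (by simp)

lemma right_mem_maximalIdeal {a b : R} (h : maximalIdeal R = Ideal.span {a, b}) :
    b ∈ maximalIdeal R := by
  rw [h]; exact Ideal.subset_span (by simp)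

lemma maximalIdeal_eq_span_of_mem {a b c d : R} (h : maximalIdeal R = Ideal.span {a, b})
    (ha : a ∈ Ideal.span {c, d}) (hb : b ∈ Ideal.span {c, d})
    (hc : c ∈ maximalIdeal R) (hd : d ∈ maximalIdeal R) :
    maximalIdeal R = Ideal.span {c, d} := by
  apply le_antisymm
  · rw [h, Ideal.span_le]
    rintro z (rfl | rfl) <;> assumption
  · rw [Ideal.span_le]
    rintro z (rfl | rfl) <;> assumption

lemma maximalIdeal_eq_span_swap {a b : R} (h : maximalIdeal R = Ideal.span {a, b}) :
    maximalIdeal R = Ideal.span {b, a} := by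
  rw [h, Set.pair_comm]

lemma maximalIdeal_eq_span_add_mul {a b : R} (h : maximalIdeal R = Ideal.span {a, b}) (c : R) :
    maximalIdeal R = Ideal.span {a + c * b, b} := by
  have ha := left_mem_maximalIdeal h
  have hb := right_mem_maximalIdeal h
  refine maximalIdeal_eq_span_of_mem h ?_ (Ideal.subset_span (by simp))
    (add_mem ha (Ideal.mul_mem_left _ _ hb)) hb
  exact Ideal.mem_span_pair.2 ⟨1, -c, by ring⟩

lemma pow_notMem_span (hreg : IsTwoDimRegularLocal R) {a b : R}
    (h : maximalIdeal R = Ideal.span {a, b}) (N : ℕ) : b ^ N ∉ Ideal.span {a} := by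
  intro hb
  obtain ⟨hN, hdim, -⟩ := hreg
  have hmin : maximalIdeal R ∈ (Ideal.span {a}).minimalPrimes := by
    refine ⟨⟨inferInstance, ?_⟩, ?_⟩
    · rw [Ideal.span_singleton_le_iff_mem]
      exact left_mem_maximalIdeal h
    · rintro q ⟨hq, hqa⟩ -
      rw [h, Ideal.span_le]
      rintro z (rfl | rfl)
      · exact hqa (Ideal.mem_span_singleton_self _)
      · exact hq.mem_of_pow_mem N (hqa hb)
  have h1 := Ideal.height_le_one_of_isPrincipal_of_mem_minimalPrimes _ _ hmin
  have h2 := IsLocalRing.maximalIdeal_height_eq_ringKrullDim (R := R)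
  rw [hdim] at h2
  have h3 : (maximalIdeal R).height = 2 := WithBot.coe_injective (h2.trans rfl)
  rw [h3] at h1
  exact absurd h1 (by decide)

/-- Modulo `a`, every element is zero or a unit times a power of `b`. -/
lemma exists_unit_pow_of_notMem_span (hreg : IsTwoDimRegularLocal R) {a b : R}
    (h : maximalIdeal R = Ideal.span {a, b}) {c : R} (hc : c ∉ Ideal.span {a}) :
    ∃ (u s : R) (k : ℕ), IsUnit u ∧ c = u * b ^ k + s * a := by
  have := hreg.1
  have hne : maximalIdeal R ≠ ⊤ := Ideal.IsPrime.ne_top'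
  have hex : ∃ k : ℕ, c ∉ Ideal.span {a} ⊔ maximalIdeal R ^ k := by
    by_contra! hall
    apply hc
    have hmem : c ∈ ⨅ i : ℕ, Ideal.span {a} ⊔ maximalIdeal R ^ i :=
      (Submodule.mem_iInf _).2 hall
    have hle : Ideal.span {a} ≤ maximalIdeal R := by
      rw [Ideal.span_singleton_le_iff_mem]; exact left_mem_maximalIdeal h
    have hq : Ideal.Quotient.mk (Ideal.span {a}) c = 0 := by
      have : Nontrivial (R ⧸ Ideal.span {a}) :=
        Ideal.Quotient.nontrivial_iff.2 (fun ht => hne (top_le_iff.1 (ht ▸ hle)))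
      have : IsLocalRing (R ⧸ Ideal.span {a}) :=
        IsLocalRing.of_surjective' _ Ideal.Quotient.mk_surjective
      have hI : (maximalIdeal R).map (Ideal.Quotient.mk (Ideal.span {a})) ≠ ⊤ := by
        intro ht
        have := congrArg (Ideal.comap (Ideal.Quotient.mk (Ideal.span {a}))) ht
        rw [Ideal.comap_map_of_surjective _ Ideal.Quotient.mk_surjective, Ideal.comap_top,
          ← RingHom.ker_eq_comap_bot, Ideal.mk_ker, sup_eq_left.2 hle] at this
        exact hne this
      have hbot := Ideal.iInf_pow_eq_bot_of_isLocalRing _ hI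
      have : Ideal.Quotient.mk (Ideal.span {a}) c ∈
          ⨅ i : ℕ, ((maximalIdeal R).map (Ideal.Quotient.mk (Ideal.span {a}))) ^ i := by
        refine (Submodule.mem_iInf _).2 fun i => ?_
        obtain ⟨s, hs, t, ht, rfl⟩ := Submodule.mem_sup.1 (hall i)
        rw [map_add, Ideal.Quotient.eq_zero_iff_mem.2 hs, zero_add, ← Ideal.map_pow]
        exact Ideal.mem_map_of_mem _ ht
      rw [hbot] at this
      simpa using this
    exact Ideal.Quotient.eq_zero_iff_mem.1 hq
  classical
  obtain ⟨k, hk, hmin⟩ : ∃ k, c ∉ Ideal.span {a} ⊔ maximalIdeal R ^ k ∧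
      ∀ j < k, c ∈ Ideal.span {a} ⊔ maximalIdeal R ^ j :=
    ⟨Nat.find hex, Nat.find_spec hex, fun j hj => not_not.1 (Nat.find_min hex hj)⟩
  have hsup : ∀ j : ℕ, Ideal.span {a} ⊔ maximalIdeal R ^ j =
      Ideal.span {a} ⊔ Ideal.span {b ^ j} := by
    intro j
    apply le_antisymm
    · refine sup_le le_sup_left ?_
      rw [h, Ideal.span_insert, ← Ideal.span_singleton_pow]
      exact sup_pow_le_sup_pow _ _ j
    · refine sup_le_sup_left ?_ _
      rw [Ideal.span_singleton_le_iff_mem]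
      exact Ideal.pow_mem_pow (right_mem_maximalIdeal h) _
  cases k with
  | zero => simp at hk
  | succ k =>
    have h1 := hmin k (Nat.lt_succ_self k)
    rw [hsup] at h1 hk
    obtain ⟨s, hs, t, ht, rfl⟩ := Submodule.mem_sup.1 h1
    obtain ⟨s, rfl⟩ := Ideal.mem_span_singleton'.1 hs
    obtain ⟨t, rfl⟩ := Ideal.mem_span_singleton'.1 ht
    refine ⟨t, s, k, isUnit_of_notMem_maximalIdeal ?_, by ring⟩
    intro htm
    rw [h] at htm
    obtain ⟨p, q, rfl⟩ := Ideal.mem_span_pair.1 htm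
    apply hk
    refine Submodule.mem_sup.2 ⟨(s + p * b ^ k) * a, ?_, q * b ^ (k + 1), ?_, by ring⟩
    · exact Ideal.mem_span_singleton'.2 ⟨_, rfl⟩
    · exact Ideal.mem_span_singleton'.2 ⟨_, rfl⟩

lemma isPrime_span_of_maximalIdeal_eq (hreg : IsTwoDimRegularLocal R) {a b : R}
    (h : maximalIdeal R = Ideal.span {a, b}) : (Ideal.span {a}).IsPrime := by
  constructor
  · intro ht
    exact pow_notMem_span hreg h 0 (ht ▸ Submodule.mem_top)
  · intro c d hcd
    by_contra! hcon
    obtain ⟨u, s, k, hu, rfl⟩ := exists_unit_pow_of_notMem_span hreg h hcon.1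
    obtain ⟨v, t, l, hv, rfl⟩ := exists_unit_pow_of_notMem_span hreg h hcon.2
    obtain ⟨w, hw⟩ := (hu.mul hv).exists_left_inv
    apply pow_notMem_span hreg h (k + l)
    obtain ⟨r, hr⟩ := Ideal.mem_span_singleton'.1 hcd
    refine Ideal.mem_span_singleton'.2 ⟨w * (r - u * b ^ k * t - s * v * b ^ l - s * t * a), ?_⟩
    linear_combination w * hr + b ^ (k + l) * hw

lemma isDomain_of_isTwoDimRegularLocal (hreg : IsTwoDimRegularLocal R) : IsDomain R := by
  obtain ⟨a, b, h⟩ := hreg.2.2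
  have := hreg.1
  have hex : ∃ k : ℕ, ∀ q ∈ minimalPrimes R, a + b ^ k * b ∉ q := by
    by_contra! hall
    choose q hq hmem using hall
    have hfin := minimalPrimes.finite_of_isNoetherianRing R
    obtain ⟨k, -, l, -, hkl, hqkl⟩ := Set.infinite_univ.exists_lt_map_eq_of_mapsTo
      (f := q) (fun k _ => hq k) hfin
    have hp : (q k).IsPrime := (hq k).1.1
    have hb : b ∈ q k := by
      have h1 : b ^ (k + 1) * (1 - b ^ (l - k)) ∈ q k := by
        have h2 := sub_mem (hmem k) (hqkl ▸ hmem l)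
        have h3 : b ^ l = b ^ k * b ^ (l - k) := by rw [← pow_add]; congr 1; omega
        convert h2 using 1
        rw [h3]; ring
      have h4 : IsUnit (1 - b ^ (l - k)) := by
        apply isUnit_of_notMem_maximalIdeal
        intro h5
        have h6 : b ^ (l - k) ∈ maximalIdeal R :=
          Ideal.pow_mem_of_mem _ (right_mem_maximalIdeal h) _ (by omega)
        have : (1 : R) ∈ maximalIdeal R := by simpa using add_mem h5 h6
        exact (notMem_maximalIdeal_of_isUnit isUnit_one) this
      rcases hp.mem_or_mem h1 with h7 | h7
      · exact hp.mem_of_pow_mem _ h7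
      · exact absurd (Ideal.eq_top_of_isUnit_mem _ h7 h4) hp.ne_top
    have ha : a ∈ q k := by
      have := sub_mem (hmem k) (Ideal.mul_mem_left _ (b ^ k) hb)
      simpa using this
    have hle : maximalIdeal R ≤ q k := by
      rw [h, Ideal.span_le]
      rintro z (rfl | rfl) <;> assumption
    have hmin : maximalIdeal R ∈ (Ideal.span {a}).minimalPrimes := by
      refine ⟨⟨inferInstance, ?_⟩, ?_⟩
      · rw [Ideal.span_singleton_le_iff_mem]
        exact left_mem_maximalIdeal h
      · rintro q' ⟨hq', hqa⟩ -
        exact hle.trans ((hq k).2 ⟨hq', bot_le⟩ (le_trans (le_maximalIdeal hq'.ne_top) hle))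
    have hpr : (Ideal.span {a}).IsPrime := isPrime_span_of_maximalIdeal_eq hreg h
    have := hmin.2 ⟨hpr, le_rfl⟩
      ((Ideal.span_singleton_le_iff_mem _).2 (left_mem_maximalIdeal h))
    exact pow_notMem_span hreg h 1 (by simpa using this (right_mem_maximalIdeal h))
  obtain ⟨k, hk⟩ := hex
  set c := a + b ^ k * b
  have hc : maximalIdeal R = Ideal.span {c, b} := maximalIdeal_eq_span_add_mul h _
  have hcp : (Ideal.span {c}).IsPrime := isPrime_span_of_maximalIdeal_eq hreg hc
  obtain ⟨Q, hQ, hQc⟩ := Ideal.exists_minimalPrimes_le (I := (⊥ : Ideal R)) (J := Ideal.span {c})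
    bot_le
  have hQp : Q.IsPrime := hQ.1.1
  have hQ0 : Q = ⊥ := by
    apply Submodule.eq_bot_of_le_smul_of_le_jacobson_bot (Ideal.span {c}) Q
      (IsNoetherian.noetherian Q)
    · intro z hz
      obtain ⟨w, rfl⟩ := Ideal.mem_span_singleton'.1 (hQc hz)
      have hw : w ∈ Q := (hQp.mem_or_mem hz).resolve_right (hk Q hQ)
      rw [mul_comm]
      exact Submodule.smul_mem_smul (Ideal.mem_span_singleton_self c) hw
    · rw [IsLocalRing.jacobson_eq_maximalIdeal ⊥ bot_ne_top, Ideal.span_singleton_le_iff_mem]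
      exact left_mem_maximalIdeal hc
  rw [hQ0] at hQp
  exact IsDomain.of_bot_isPrime R

end RegularLocal

section Order

variable {R : Type*} [CommRing R]

lemma memIntClosure_of_mem {I : Ideal R} {z : R} (hz : z ∈ I) : MemIntClosure I z := by
  refine ⟨1, one_pos, fun _ => -z, ?_, by simp⟩
  intro i hi
  obtain rfl : i = 1 := by simpa [and_comm, le_antisymm_iff] using hi
  simpa using hz

lemma MemIntClosure.mul_of_forall_mul_mem {I J : Ideal R} {z q : R} (hz : MemIntClosure J z)
    (hq : ∀ j ∈ J, j * q ∈ I) : MemIntClosure I (z * q) := by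
  obtain ⟨n, hn, c, hc, h⟩ := hz
  refine ⟨n, hn, fun i => c i * q ^ i, ?_, ?_⟩
  · intro i hi
    have h1 : Ideal.span {q} * J ≤ I := by
      rw [Ideal.span_singleton_mul_le_iff]
      intro j hj
      rw [mul_comm]
      exact hq j hj
    have h2 : q ^ i * c i ∈ (Ideal.span {q} * J) ^ i := by
      rw [mul_pow]
      exact Ideal.mul_mem_mul (Ideal.pow_mem_pow (Ideal.mem_span_singleton_self q) i) (hc i hi)
    change c i * q ^ i ∈ I ^ i
    rw [mul_comm]
    exact Ideal.pow_right_mono h1 i h2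
  · have h3 : ∑ i ∈ Finset.Icc 1 n, c i * q ^ i * (z * q) ^ (n - i) =
        q ^ n * ∑ i ∈ Finset.Icc 1 n, c i * z ^ (n - i) := by
      rw [Finset.mul_sum]
      refine Finset.sum_congr rfl fun i hi => ?_
      have h4 : q ^ n = q ^ i * q ^ (n - i) := by
        rw [← pow_add]; congr 1; have := (Finset.mem_Icc.1 hi).2; omega
      rw [h4, mul_pow]; ring
    simp only [h3]
    rw [mul_pow]
    linear_combination q ^ n * h

/-- The determinant trick. -/
lemma memIntClosure_of_forall_mul_mem_mul [IsDomain R] [IsNoetherianRing R] {I B : Ideal R}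
    (hB : B ≠ ⊥) {z : R} (hz : ∀ b ∈ B, z * b ∈ I * B) : MemIntClosure I z := by
  let f : Module.End R B :=
    { toFun := fun b => ⟨z * b, B.mul_mem_left z b.2⟩
      map_add' := fun a b => Subtype.ext (mul_add _ _ _)
      map_smul' := fun r b => Subtype.ext (by simp; ring) }
  have hrange : LinearMap.range f ≤ I • (⊤ : Submodule R B) := by
    rintro _ ⟨b, rfl⟩
    have h1 : ((f b : B) : R) ∈ Submodule.map B.subtype (I • (⊤ : Submodule R B)) := by
      rw [Submodule.map_smul'', Submodule.map_top, Submodule.range_subtype, smul_eq_mul]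
      exact hz b b.2
    obtain ⟨c, hc, hcb⟩ := h1
    have : c = f b := Subtype.ext hcb
    rwa [← this]
  obtain ⟨p, hp, -, hcoeff, hap⟩ :=
    LinearMap.exists_monic_and_natDegree_eq_and_coeff_mem_pow_and_aeval_eq_zero R f I hrange
  obtain ⟨b, hb, hb0⟩ := Submodule.exists_mem_ne_zero_of_ne_bot hB
  have hpow : ∀ k : ℕ, (((f ^ k) ⟨b, hb⟩ : B) : R) = z ^ k * b := by
    intro k
    induction k with
    | zero => simp
    | succ k ih =>
      rw [pow_succ', Module.End.mul_apply]
      change z * _ = _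
      rw [ih]; ring
  have hev : p.eval z = 0 := by
    have h2 := congrArg (fun g : Module.End R B => ((g ⟨b, hb⟩ : B) : R)) hap
    simp only [Polynomial.aeval_eq_sum_range, LinearMap.sum_apply, LinearMap.smul_apply,
      AddSubmonoidClass.coe_finsetSum, Submodule.coe_smul, hpow, LinearMap.zero_apply,
      ZeroMemClass.coe_zero, smul_eq_mul] at h2
    have h3 : p.eval z * b = 0 := by
      rw [Polynomial.eval_eq_sum_range, Finset.sum_mul, ← h2]
      exact Finset.sum_congr rfl fun i _ => by ring
    exact (mul_eq_zero.1 h3).resolve_right hb0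
  have hn : 0 < p.natDegree := by
    rcases Nat.eq_zero_or_pos p.natDegree with h0 | h0
    · rw [hp.natDegree_eq_zero.1 h0] at hev
      simp at hev
    · exact h0
  refine ⟨p.natDegree, hn, fun i => p.coeff (p.natDegree - i), ?_, ?_⟩
  · intro i hi
    have h4 := hcoeff (p.natDegree - i)
    rwa [Nat.sub_sub_self (Finset.mem_Icc.1 hi).2] at h4
  · rw [Polynomial.eval_eq_sum_range, Finset.sum_range_succ, hp.coeff_natDegree, one_mul] at hev
    rw [← hev, add_comm]
    congr 1
    refine Finset.sum_nbij' (fun i => p.natDegree - i) (fun i => p.natDegree - i) ?_ ?_ ?_ ?_ ?_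
    all_goals intro i hi
    all_goals simp only [Finset.mem_Icc, Finset.mem_range] at *
    · omega
    · omega
    · omega
    · omega

variable [IsLocalRing R]

lemma mem_maximalIdeal_mul_iff {a b z : R} (h : maximalIdeal R = Ideal.span {a, b})
    {B : Ideal R} : z ∈ maximalIdeal R * B ↔ ∃ p ∈ B, ∃ q ∈ B, z = a * p + b * q := by
  rw [h, Ideal.span_insert, Ideal.sup_mul, Submodule.mem_sup]
  simp only [Ideal.mem_span_singleton_mul]
  constructor
  · rintro ⟨_, ⟨p, hp, rfl⟩, _, ⟨q, hq, rfl⟩, rfl⟩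
    exact ⟨p, hp, q, hq, rfl⟩
  · rintro ⟨p, hp, q, hq, rfl⟩
    exact ⟨_, ⟨p, hp, rfl⟩, _, ⟨q, hq, rfl⟩, rfl⟩

lemma exists_of_mem_pow_succ {a b z : R} (h : maximalIdeal R = Ideal.span {a, b}) {k : ℕ}
    (hz : z ∈ maximalIdeal R ^ (k + 1)) :
    ∃ m ∈ maximalIdeal R ^ k, ∃ c : R, z = a * m + c * b ^ (k + 1) := by
  induction k generalizing z with
  | zero =>
    rw [zero_add, pow_one, h] at hz
    obtain ⟨p, q, rfl⟩ := Ideal.mem_span_pair.1 hz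
    exact ⟨p, by simp, q, by ring⟩
  | succ k ih =>
    rw [pow_succ', mem_maximalIdeal_mul_iff h] at hz
    obtain ⟨p, hp, q, hq, rfl⟩ := hz
    obtain ⟨m, hm, c, rfl⟩ := ih hq
    refine ⟨p + b * m, add_mem hp ?_, c, by ring⟩
    rw [pow_succ']
    exact Ideal.mul_mem_mul (right_mem_maximalIdeal h) hm

lemma isPrime_pair (hreg : IsTwoDimRegularLocal R) {a b : R}
    (h : maximalIdeal R = Ideal.span {a, b}) {c : R} {k : ℕ} (hc : b ^ k * c ∈ Ideal.span {a}) :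
    c ∈ Ideal.span {a} :=
  ((isPrime_span_of_maximalIdeal_eq hreg h).mem_or_mem hc).resolve_left (pow_notMem_span hreg h k)

lemma ne_zero_of_maximalIdeal_eq (hreg : IsTwoDimRegularLocal R) {a b : R}
    (h : maximalIdeal R = Ideal.span {a, b}) : a ≠ 0 := by
  rintro rfl
  exact pow_notMem_span hreg (maximalIdeal_eq_span_swap h) 1 (by simp)

lemma mem_maximalIdeal_of_mul_pow_eq (hreg : IsTwoDimRegularLocal R) {a b : R}
    (h : maximalIdeal R = Ideal.span {a, b}) {c s t : R} {k : ℕ}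
    (ht : t ∈ maximalIdeal R ^ (k + 1)) (hc : c * b ^ k = a * s + t) : c ∈ maximalIdeal R := by
  obtain ⟨m, -, d, rfl⟩ := exists_of_mem_pow_succ h ht
  have h1 : c - d * b ∈ Ideal.span {a} := by
    refine isPrime_pair hreg h (k := k) (Ideal.mem_span_singleton'.2 ⟨s + m, ?_⟩)
    linear_combination -hc
  have h2 : c - d * b ∈ maximalIdeal R :=
    (Ideal.span_singleton_le_iff_mem _).2 (left_mem_maximalIdeal h) h1
  simpa using add_mem h2 (Ideal.mul_mem_left _ d (right_mem_maximalIdeal h))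

lemma exists_pair_of_notMem_sq (hreg : IsTwoDimRegularLocal R) {j : R}
    (hj : j ∈ maximalIdeal R) (hj2 : j ∉ maximalIdeal R ^ 2) :
    ∃ b, maximalIdeal R = Ideal.span {j, b} := by
  obtain ⟨x, y, h⟩ := hreg.2.2
  have hx := left_mem_maximalIdeal h
  have hy := right_mem_maximalIdeal h
  have hj' := hj
  rw [h] at hj'
  obtain ⟨p, q, rfl⟩ := Ideal.mem_span_pair.1 hj'
  by_cases hp : p ∈ maximalIdeal R
  · by_cases hq : q ∈ maximalIdeal R
    · refine absurd (add_mem ?_ ?_) hj2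
      · rw [pow_two]; exact Ideal.mul_mem_mul hp hx
      · rw [pow_two]; exact Ideal.mul_mem_mul hq hy
    · obtain ⟨u, hu⟩ := (isUnit_of_notMem_maximalIdeal hq).exists_left_inv
      refine ⟨x, maximalIdeal_eq_span_of_mem h (Ideal.subset_span (by simp)) ?_ hj hx⟩
      exact Ideal.mem_span_pair.2 ⟨u, -u * p, by linear_combination y * hu⟩
  · obtain ⟨u, hu⟩ := (isUnit_of_notMem_maximalIdeal hp).exists_left_inv
    refine ⟨y, maximalIdeal_eq_span_of_mem h ?_ (Ideal.subset_span (by simp)) hj hy⟩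
    exact Ideal.mem_span_pair.2 ⟨u, -u * q, by linear_combination x * hu⟩

variable [IsDomain R]

lemma mem_pow_of_left_mul_mem (hreg : IsTwoDimRegularLocal R) {a b : R}
    (h : maximalIdeal R = Ideal.span {a, b}) {z : R} {k : ℕ}
    (hz : a * z ∈ maximalIdeal R ^ (k + 1)) : z ∈ maximalIdeal R ^ k := by
  obtain ⟨m, hm, c, hc⟩ := exists_of_mem_pow_succ h hz
  have h1 : c ∈ Ideal.span {a} := by
    refine isPrime_pair hreg h (k := k + 1) (Ideal.mem_span_singleton'.2 ⟨z - m, ?_⟩)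
    linear_combination hc
  obtain ⟨d, rfl⟩ := Ideal.mem_span_singleton'.1 h1
  have h2 : z = m + d * b ^ (k + 1) := by
    apply mul_left_cancel₀ (ne_zero_of_maximalIdeal_eq hreg h)
    linear_combination hc
  rw [h2]
  refine add_mem hm (Ideal.mul_mem_left _ _ ?_)
  exact Ideal.pow_le_pow_right (Nat.le_succ k) (Ideal.pow_mem_pow (right_mem_maximalIdeal h) _)

lemma mem_pow_of_mul_mem (hreg : IsTwoDimRegularLocal R) {j z : R} {k : ℕ}
    (hj : j ∈ maximalIdeal R) (hj2 : j ∉ maximalIdeal R ^ 2)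
    (hz : j * z ∈ maximalIdeal R ^ (k + 1)) : z ∈ maximalIdeal R ^ k := by
  obtain ⟨b, h⟩ := exists_pair_of_notMem_sq hreg hj hj2
  exact mem_pow_of_left_mul_mem hreg h hz

lemma maximalIdeal_pow_ne_bot (hreg : IsTwoDimRegularLocal R) (k : ℕ) :
    maximalIdeal R ^ k ≠ ⊥ := by
  obtain ⟨x, y, h⟩ := hreg.2.2
  intro h0
  have := Ideal.pow_mem_pow (left_mem_maximalIdeal h) k
  rw [h0] at this
  exact pow_ne_zero k (ne_zero_of_maximalIdeal_eq hreg h) (by simpa using this)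

lemma IdealIntClosed.mem_of_forall_mul_mem {I : Ideal R} (hI : IdealIntClosed I)
    (hreg : IsTwoDimRegularLocal R) (k : ℕ) {z : R}
    (hz : ∀ m ∈ maximalIdeal R ^ k, z * m ∈ I * maximalIdeal R ^ k) : z ∈ I :=
  have := hreg.1
  hI z (memIntClosure_of_forall_mul_mem_mul (maximalIdeal_pow_ne_bot hreg k) hz)

lemma mem_sq_of_memIntClosure (hreg : IsTwoDimRegularLocal R) {K : Ideal R}
    (hK : K ≤ maximalIdeal R ^ 2) {z : R} (hz : MemIntClosure K z) :
    z ∈ maximalIdeal R ^ 2 := by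
  obtain ⟨n, hn, c, hc, h⟩ := hz
  have hcm : ∀ i ∈ Finset.Icc 1 n, c i ∈ maximalIdeal R ^ (2 * i) := fun i hi => by
    rw [pow_mul]
    exact Ideal.pow_right_mono hK i (hc i hi)
  have hzm : z ∈ maximalIdeal R := by
    have h1 : z ^ n ∈ maximalIdeal R := by
      rw [eq_neg_of_add_eq_zero_left h]
      refine neg_mem (sum_mem fun i hi => Ideal.mul_mem_right _ _ ?_)
      exact Ideal.pow_le_self (by have := (Finset.mem_Icc.1 hi).1; omega) (hcm i hi)
    exact Ideal.IsPrime.mem_of_pow_mem inferInstance n h1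
  by_contra hz2
  have h2 : z ^ n ∈ maximalIdeal R ^ (n + 1) := by
    rw [eq_neg_of_add_eq_zero_left h]
    refine neg_mem (sum_mem fun i hi => ?_)
    have := Finset.mem_Icc.1 hi
    have h3 : c i * z ^ (n - i) ∈ maximalIdeal R ^ (2 * i) * maximalIdeal R ^ (n - i) :=
      Ideal.mul_mem_mul (hcm i hi) (Ideal.pow_mem_pow hzm _)
    rw [← pow_add] at h3
    exact Ideal.pow_le_pow_right (by omega) h3
  have h4 : ∀ k, z ^ k ∈ maximalIdeal R ^ (k + 1) → False := by
    intro k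
    induction k with
    | zero => intro hk; simp at hk
    | succ k ih =>
      intro hk
      rw [pow_succ' z k] at hk
      exact ih (mem_pow_of_mul_mem hreg hzm hz2 hk)
  exact h4 n h2

lemma coeff_mem_of_quadratic_mem (hreg : IsTwoDimRegularLocal R) {x y : R}
    (h : maximalIdeal R = Ideal.span {x, y}) {a b c : R}
    (hq : a * x ^ 2 + b * (x * y) + c * y ^ 2 ∈ maximalIdeal R ^ 3) :
    a ∈ maximalIdeal R ∧ b ∈ maximalIdeal R ∧ c ∈ maximalIdeal R := by
  have hx := left_mem_maximalIdeal h
  have hy := right_mem_maximalIdeal h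
  have hc : c ∈ maximalIdeal R :=
    mem_maximalIdeal_of_mul_pow_eq hreg h (k := 2) hq (s := -(a * x + b * y)) (by ring)
  have h1 : x * (a * x + b * y) ∈ maximalIdeal R ^ (2 + 1) := by
    have h2 : c * y ^ 2 ∈ maximalIdeal R ^ (2 + 1) := by
      rw [pow_succ']; exact Ideal.mul_mem_mul hc (Ideal.pow_mem_pow hy 2)
    convert sub_mem hq h2 using 1; ring
  have h3 := mem_pow_of_left_mul_mem hreg h h1
  have hb : b ∈ maximalIdeal R :=
    mem_maximalIdeal_of_mul_pow_eq hreg h (k := 1) h3 (s := -a) (by ring)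
  refine ⟨?_, hb, hc⟩
  have h4 : x * a ∈ maximalIdeal R ^ (1 + 1) := by
    have h5 : b * y ∈ maximalIdeal R ^ 2 := by rw [pow_two]; exact Ideal.mul_mem_mul hb hy
    convert sub_mem h3 h5 using 1; ring
  simpa using mem_pow_of_left_mul_mem hreg h h4

end Order

section Module

variable {R : Type*} [CommRing R]

/-- The determinant of the `3 × 3` matrix with columns `u`, `v`, `w`, expanded. -/
def tripleDet (u v w : Fin 3 → R) : R :=
  u 0 * (v 1 * w 2 - v 2 * w 1) - u 1 * (v 0 * w 2 - v 2 * w 0) + u 2 * (v 0 * w 1 - v 1 * w 0)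

lemma colDet_eq_tripleDet (w : Fin 3 → Fin 3 → R) : colDet w = tripleDet (w 0) (w 1) (w 2) := by
  simp only [colDet, tripleDet, Matrix.det_fin_three, Matrix.of_apply]
  ring

lemma tripleDet_mem_maxMinors {M : Submodule R (Fin 3 → R)} {u v w : Fin 3 → R} (hu : u ∈ M)
    (hv : v ∈ M) (hw : w ∈ M) : tripleDet u v w ∈ maxMinors M := by
  refine Ideal.subset_span ⟨![u, v, w], ?_, ?_⟩
  · intro j; fin_cases j <;> assumption
  · rw [colDet_eq_tripleDet]; rfl

lemma maxMinors_le_iff {M : Submodule R (Fin 3 → R)} {I : Ideal R} :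
    maxMinors M ≤ I ↔ ∀ u ∈ M, ∀ v ∈ M, ∀ w ∈ M, tripleDet u v w ∈ I := by
  constructor
  · exact fun h u hu v hv w hw => h (tripleDet_mem_maxMinors hu hv hw)
  · intro h
    rw [maxMinors, Ideal.span_le]
    rintro _ ⟨w, hw, rfl⟩
    rw [SetLike.mem_coe, colDet_eq_tripleDet]
    exact h _ (hw 0) _ (hw 1) _ (hw 2)

lemma IntegralOverMod.memIntClosure_tripleDet {M : Submodule R (Fin 3 → R)} {v u w : Fin 3 → R}
    (h : IntegralOverMod M v) (hu : u ∈ M) (hw : w ∈ M) :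
    MemIntClosure (maxMinors M) (tripleDet v u w) := by
  have := h ![v, u, w] 0 rfl (by
    intro j hj; fin_cases j <;> first | exact absurd rfl hj | assumption)
  rwa [colDet_eq_tripleDet] at this

lemma integralOverMod_of_forall_tripleDet {M : Submodule R (Fin 3 → R)} {v : Fin 3 → R}
    (h : ∀ u ∈ M, ∀ w ∈ M, tripleDet v u w ∈ maxMinors M) : IntegralOverMod M v := by
  intro w j₀ hv hw
  apply memIntClosure_of_mem
  rw [colDet_eq_tripleDet]
  fin_cases j₀
  · have := h _ (hw 1 (by decide)) _ (hw 2 (by decide))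
    rw [← hv] at this
    exact this
  · have := neg_mem (h _ (hw 0 (by decide)) _ (hw 2 (by decide)))
    rw [← hv] at this
    convert this using 1
    simp only [tripleDet, Fin.mk_one]; ring
  · have := h _ (hw 0 (by decide)) _ (hw 1 (by decide))
    rw [← hv] at this
    convert this using 1
    simp only [tripleDet, Fin.reduceFinMk]; ring

/-- The vectors multiplied into `N` by both `a` and `b`. -/
def saturation {r : ℕ} (N : Submodule R (Fin r → R)) (a b : R) : Submodule R (Fin r → R) :=
  N.comap (LinearMap.lsmul R _ a) ⊓ N.comap (LinearMap.lsmul R _ b)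

lemma le_saturation {r : ℕ} (N : Submodule R (Fin r → R)) (a b : R) : N ≤ saturation N a b :=
  fun _ hv => ⟨N.smul_mem _ hv, N.smul_mem _ hv⟩

variable [IsLocalRing R]

lemma FinColength.exists_pow_smul_mem {r : ℕ} {M : Submodule R (Fin r → R)} (hM : FinColength M) :
    ∃ k, ∀ a ∈ maximalIdeal R ^ k, ∀ v, a • v ∈ M := by
  obtain ⟨_, _⟩ := isFiniteLength_iff_isNoetherian_isArtinian.1 hM
  let f : ℕ →o (Submodule R ((Fin r → R) ⧸ M))ᵒᵈ :=
    ⟨fun k => OrderDual.toDual (maximalIdeal R ^ k • ⊤),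
      fun a b hab => Submodule.smul_mono_left (Ideal.pow_le_pow_right hab)⟩
  obtain ⟨k, hk⟩ := IsArtinian.monotone_stabilizes f
  have h1 : maximalIdeal R ^ k • (⊤ : Submodule R ((Fin r → R) ⧸ M)) = ⊥ := by
    refine Submodule.eq_bot_of_le_smul_of_le_jacobson_bot (maximalIdeal R) _
      (IsNoetherian.noetherian _) ?_ (IsLocalRing.maximalIdeal_le_jacobson _)
    rw [← Submodule.mul_smul, ← pow_succ']
    exact (congrArg OrderDual.ofDual (hk (k + 1) (Nat.le_succ k))).le
  refine ⟨k, fun a ha v => ?_⟩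
  have h2 := Submodule.smul_mem_smul ha (Submodule.mem_top (x := M.mkQ v))
  rw [h1, Submodule.mem_bot, ← map_smul] at h2
  exact (Submodule.Quotient.mk_eq_zero M).1 h2

lemma pow_dvd_of_pow_dvd_mul [IsDomain R] (hreg : IsTwoDimRegularLocal R) {x y : R}
    (h : maximalIdeal R = Ideal.span {x, y}) {a : R} {k l : ℕ} (ha : x ^ k ∣ y ^ l * a) :
    x ^ k ∣ a := by
  induction k generalizing a with
  | zero => simp
  | succ k ih =>
    have h1 : x ∣ y ^ l * a := (dvd_pow_self x (Nat.succ_ne_zero k)).trans ha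
    have h2 := isPrime_pair hreg h (Ideal.mem_span_singleton.2 h1)
    obtain ⟨b, rfl⟩ := Ideal.mem_span_singleton.1 h2
    rw [pow_succ']
    refine mul_dvd_mul_left x (ih ?_)
    rw [pow_succ', mul_left_comm] at ha
    exact (mul_dvd_mul_iff_left (ne_zero_of_maximalIdeal_eq hreg h)).1 ha

lemma isCompl_saturation [IsDomain R] (hreg : IsTwoDimRegularLocal R) {x y : R}
    (h : maximalIdeal R = Ideal.span {x, y}) {r k : ℕ} {N P : Submodule R (Fin r → R)}
    (hNP : N ⊓ P = ⊥) (hk : ∀ a ∈ maximalIdeal R ^ k, ∀ v, a • v ∈ N ⊔ P) :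
    IsCompl (saturation N (x ^ k) (y ^ k)) (saturation P (x ^ k) (y ^ k)) := by
  have hx0 : x ^ k ≠ 0 := pow_ne_zero k (ne_zero_of_maximalIdeal_eq hreg h)
  have hy0 : y ^ k ≠ 0 :=
    pow_ne_zero k (ne_zero_of_maximalIdeal_eq hreg (maximalIdeal_eq_span_swap h))
  have key : ∀ n1 n2 : Fin r → R, y ^ k • n1 = x ^ k • n2 →
      ∃ n, n1 = x ^ k • n ∧ n2 = y ^ k • n := by
    intro n1 n2 h12
    have h1 : ∀ i, ∃ c, n1 i = x ^ k * c := fun i =>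
      pow_dvd_of_pow_dvd_mul hreg h (l := k) ⟨n2 i, congrFun h12 i⟩
    choose n hn using h1
    have hn' : n1 = x ^ k • n := funext hn
    refine ⟨n, hn', ?_⟩
    rw [hn', smul_comm] at h12
    exact (smul_right_injective _ hx0 h12).symm
  refine IsCompl.of_eq ?_ ?_
  · rw [eq_bot_iff]
    rintro v ⟨⟨h1, -⟩, ⟨h2, -⟩⟩
    have h3 : x ^ k • v ∈ N ⊓ P := ⟨h1, h2⟩
    rw [hNP, Submodule.mem_bot, smul_eq_zero] at h3
    exact h3.resolve_left hx0
  · rw [eq_top_iff]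
    intro v _
    obtain ⟨n1, hn1, p1, hp1, e1⟩ :=
      Submodule.mem_sup.1 (hk _ (Ideal.pow_mem_pow (left_mem_maximalIdeal h) k) v)
    obtain ⟨n2, hn2, p2, hp2, e2⟩ :=
      Submodule.mem_sup.1 (hk _ (Ideal.pow_mem_pow (right_mem_maximalIdeal h) k) v)
    have e3 : y ^ k • n1 - x ^ k • n2 = x ^ k • p2 - y ^ k • p1 := by
      have h3 : y ^ k • (n1 + p1) = x ^ k • (n2 + p2) := by rw [e1, e2, smul_comm]
      rw [smul_add, smul_add] at h3
      rw [sub_eq_sub_iff_add_eq_add, h3, add_comm]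
    have h4 : y ^ k • n1 - x ^ k • n2 ∈ N ⊓ P :=
      ⟨sub_mem (N.smul_mem _ hn1) (N.smul_mem _ hn2),
        e3 ▸ sub_mem (P.smul_mem _ hp2) (P.smul_mem _ hp1)⟩
    rw [hNP, Submodule.mem_bot] at h4
    obtain ⟨n, rfl, rfl⟩ := key n1 n2 (sub_eq_zero.1 h4)
    obtain ⟨p, rfl, rfl⟩ := key p1 p2 (sub_eq_zero.1 (e3.symm.trans h4)).symm
    refine Submodule.mem_sup.2 ⟨n, ⟨hn1, hn2⟩, p, ⟨hp1, hp2⟩, ?_⟩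
    rw [← smul_add] at e1
    exact smul_right_injective _ hx0 e1

lemma exists_splitting_of_finrank_eq_one [IsDomain R] {r : ℕ}
    {N P N' P' : Submodule R (Fin r → R)} (hN : N ≤ N') (hP : P ≤ P') (h : IsCompl N' P')
    [Module.Free R N'] (h1 : Module.finrank R N' = 1) [Module.Finite R N'] :
    ∃ (f : Fin r → R) (c : (Fin r → R) →ₗ[R] R), c f = 1 ∧
      ∀ v ∈ N ⊔ P, c v • f ∈ N ⊔ P := by
  let b := Module.finBasisOfFinrankEq R N' h1
  refine ⟨b 0, b.coord 0 ∘ₗ Submodule.projectionOnto _ _ h, by simp, ?_⟩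
  intro v hv
  obtain ⟨n, hn, p, hp, rfl⟩ := Submodule.mem_sup.1 hv
  have h2 : Submodule.projectionOnto _ _ h (n + p) = ⟨n, hN hn⟩ := by
    rw [map_add, Submodule.projectionOnto_apply_of_mem_right _ (hP hp), add_zero]
    exact Submodule.projectionOnto_apply_left h ⟨n, hN hn⟩
  have h3 : b.coord 0 ⟨n, hN hn⟩ • b 0 = ⟨n, hN hn⟩ := by
    simpa using b.sum_repr ⟨n, hN hn⟩
  have h4 := congrArg Subtype.val h3
  rw [LinearMap.comp_apply, h2]
  change b.coord 0 ⟨n, hN hn⟩ • (b 0 : Fin r → R) = n at h4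
  rw [h4]
  exact Submodule.mem_sup_left hn

lemma DecomposableSub.exists_splitting [IsDomain R] (hreg : IsTwoDimRegularLocal R)
    {M : Submodule R (Fin 3 → R)} (hM : FinColength M) (hD : DecomposableSub M) :
    ∃ (f : Fin 3 → R) (c : (Fin 3 → R) →ₗ[R] R), c f = 1 ∧ ∀ v ∈ M, c v • f ∈ M := by
  have := hreg.1
  obtain ⟨x, y, h⟩ := hreg.2.2
  obtain ⟨k, hk⟩ := hM.exists_pow_smul_mem
  obtain ⟨N, P, rfl, hNP, hN, hP⟩ := hD
  have hc := isCompl_saturation hreg h hNP hk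
  have hleN := le_saturation N (x ^ k) (y ^ k)
  have hleP := le_saturation P (x ^ k) (y ^ k)
  set N' := saturation N (x ^ k) (y ^ k)
  set P' := saturation P (x ^ k) (y ^ k)
  let e := Submodule.prodEquivOfIsCompl N' P' hc
  have : Module.Projective R (N' × P') := Module.Projective.of_equiv e.symm
  have : Module.Projective R N' :=
    Module.Projective.of_split (LinearMap.inl R N' P') (LinearMap.fst R N' P') (by ext; simp)
  have : Module.Projective R P' :=
    Module.Projective.of_split (LinearMap.inr R N' P') (LinearMap.snd R N' P') (by ext; simp)
  have : Module.Free R N' := Module.free_of_flat_of_isLocalRing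
  have : Module.Free R P' := Module.free_of_flat_of_isLocalRing
  have : Nontrivial N' := Submodule.nontrivial_iff_ne_bot.2 (ne_bot_of_le_ne_bot hN hleN)
  have : Nontrivial P' := Submodule.nontrivial_iff_ne_bot.2 (ne_bot_of_le_ne_bot hP hleP)
  have h3 := e.finrank_eq
  rw [Module.finrank_prod, Module.finrank_fin_fun] at h3
  have h4 : 0 < Module.finrank R N' := Module.finrank_pos
  have h5 : 0 < Module.finrank R P' := Module.finrank_pos
  rcases (by omega : Module.finrank R N' = 1 ∨ Module.finrank R P' = 1) with h6 | h6
  · exact exists_splitting_of_finrank_eq_one hleN hleP hc h6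
  · rw [sup_comm]
    exact exists_splitting_of_finrank_eq_one hleP hleN hc.symm h6

lemma exists_ne_zero_apply_eq_zero [IsDomain R] (c : (Fin 3 → R) →ₗ[R] R) :
    ∃ e, e ≠ 0 ∧ c e = 0 := by
  by_cases h0 : c (Pi.single 0 1) = 0
  · exact ⟨Pi.single 0 1, by simp, h0⟩
  · refine ⟨c (Pi.single 1 1) • Pi.single 0 1 - c (Pi.single 0 1) • Pi.single 1 1, ?_, ?_⟩
    · intro h
      exact h0 (by simpa using congrFun h 1)
    · simp [mul_comm]

lemma decomposableSub_of_splitting [IsDomain R] (hreg : IsTwoDimRegularLocal R)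
    {M : Submodule R (Fin 3 → R)} (hM : FinColength M) {f : Fin 3 → R}
    {c : (Fin 3 → R) →ₗ[R] R} (hcf : c f = 1) (hfM : ∀ v ∈ M, c v • f ∈ M) :
    DecomposableSub M := by
  obtain ⟨x, y, h⟩ := hreg.2.2
  obtain ⟨k, hk⟩ := hM.exists_pow_smul_mem
  have hx := Ideal.pow_mem_pow (left_mem_maximalIdeal h) k
  have hx0 : x ^ k ≠ 0 := pow_ne_zero k (ne_zero_of_maximalIdeal_eq hreg h)
  refine ⟨M ⊓ R ∙ f, M ⊓ LinearMap.ker c, ?_, ?_, ?_, ?_⟩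
  · refine le_antisymm (sup_le inf_le_left inf_le_left) fun v hv => ?_
    refine Submodule.mem_sup.2 ⟨c v • f, ⟨hfM v hv, Submodule.mem_span_singleton.2 ⟨_, rfl⟩⟩,
      v - c v • f, ⟨sub_mem hv (hfM v hv), ?_⟩, by simp⟩
    simp [hcf]
  · rw [eq_bot_iff]
    rintro v ⟨⟨-, h1⟩, ⟨-, h2⟩⟩
    obtain ⟨a, rfl⟩ := Submodule.mem_span_singleton.1 h1
    have : a = 0 := by simpa [hcf] using h2
    simp [this]
  · have hf : f ≠ 0 := by rintro rfl; simp at hcf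
    refine (Submodule.ne_bot_iff _).2 ⟨x ^ k • f, ⟨hk _ hx f, ?_⟩, smul_ne_zero hx0 hf⟩
    exact Submodule.mem_span_singleton.2 ⟨_, rfl⟩
  · obtain ⟨e, he, hce⟩ := exists_ne_zero_apply_eq_zero c
    refine (Submodule.ne_bot_iff _).2 ⟨x ^ k • e, ⟨hk _ hx e, ?_⟩, smul_ne_zero hx0 he⟩
    simp [hce]

end Module

section TripleDet

variable {R : Type*} [CommRing R]

lemma apply_eq_of_fin_three (c : (Fin 3 → R) →ₗ[R] R) (v : Fin 3 → R) :
    c v = v 0 * c (Pi.single 0 1) + v 1 * c (Pi.single 1 1) + v 2 * c (Pi.single 2 1) := by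
  conv_lhs => rw [← Finset.univ_sum_single v, map_sum, Fin.sum_univ_three]
  have (i : Fin 3) : (Pi.single i (v i) : Fin 3 → R) = v i • Pi.single i 1 := by
    rw [← Pi.single_smul, smul_eq_mul, mul_one]
  simp only [this, map_smul, smul_eq_mul]

lemma LinearMap.apply_mem_of_forall_mem (c : (Fin 3 → R) →ₗ[R] R) {A : Ideal R} {v : Fin 3 → R}
    (hv : ∀ i, v i ∈ A) : c v ∈ A := by
  rw [apply_eq_of_fin_three]
  exact add_mem (add_mem (A.mul_mem_right _ (hv 0)) (A.mul_mem_right _ (hv 1)))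
    (A.mul_mem_right _ (hv 2))

/-- The Cramer rule, evaluated at a linear functional. -/
lemma tripleDet_mul_apply (c : (Fin 3 → R) →ₗ[R] R) (u v w f : Fin 3 → R) :
    tripleDet u v w * c f =
      c u * tripleDet f v w - c v * tripleDet f u w + c w * tripleDet f u v := by
  rw [apply_eq_of_fin_three c u, apply_eq_of_fin_three c v, apply_eq_of_fin_three c w,
    apply_eq_of_fin_three c f]
  simp only [tripleDet]
  ring

lemma tripleDet_smul_eq (f u t v : Fin 3 → R) :
    tripleDet f u t • v =
      tripleDet v u t • f + tripleDet f v t • u + tripleDet f u v • t := by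
  ext i
  fin_cases i <;> simp [tripleDet] <;> ring

lemma tripleDet_mem_mul {A B C : Ideal R} {u v w : Fin 3 → R} (hu : ∀ i, u i ∈ A)
    (hv : ∀ i, v i ∈ B) (hw : ∀ i, w i ∈ C) : tripleDet u v w ∈ A * (B * C) := by
  have h (i j k : Fin 3) : u i * (v j * w k) ∈ A * (B * C) :=
    Ideal.mul_mem_mul (hu i) (Ideal.mul_mem_mul (hv j) (hw k))
  simp only [tripleDet, mul_sub]
  exact add_mem (sub_mem (sub_mem (h _ _ _) (h _ _ _)) (sub_mem (h _ _ _) (h _ _ _)))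
    (sub_mem (h _ _ _) (h _ _ _))

lemma tripleDet_mem_of_middle {A : Ideal R} {u v w : Fin 3 → R} (hv : ∀ i, v i ∈ A) :
    tripleDet u v w ∈ A := by
  simpa using tripleDet_mem_mul (A := ⊤) (C := ⊤) (u := u) (w := w) (fun i => trivial) hv
    fun i => trivial

lemma tripleDet_mem_of_right {A : Ideal R} {u v w : Fin 3 → R} (hw : ∀ i, w i ∈ A) :
    tripleDet u v w ∈ A := by
  simpa using tripleDet_mem_mul (A := ⊤) (B := ⊤) (u := u) (v := v) (fun i => trivial)
    (fun i => trivial) hw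

lemma tripleDet_mem_sq {A : Ideal R} {u v w : Fin 3 → R} (hv : ∀ i, v i ∈ A)
    (hw : ∀ i, w i ∈ A) : tripleDet u v w ∈ A ^ 2 := by
  simpa [pow_two] using tripleDet_mem_mul (A := ⊤) (u := u) (fun i => trivial) hv hw

lemma tripleDet_mem_cube {A : Ideal R} {u v w : Fin 3 → R} (hu : ∀ i, u i ∈ A)
    (hv : ∀ i, v i ∈ A) (hw : ∀ i, w i ∈ A) : tripleDet u v w ∈ A ^ 3 := by
  rw [pow_succ', pow_two]
  exact tripleDet_mem_mul hu hv hw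

/-- `tripleDet` as a linear function of its last argument. -/
def tripleDetRight (u v : Fin 3 → R) : (Fin 3 → R) →ₗ[R] R where
  toFun w := tripleDet u v w
  map_add' a b := by simp only [tripleDet, Pi.add_apply]; ring
  map_smul' a b := by simp only [tripleDet, Pi.smul_apply, smul_eq_mul, RingHom.id_apply]; ring

/-- The functional with coefficients `x ^ 2`, `x * y`, `y ^ 2`. -/
def quadFunctional (x y : R) : (Fin 3 → R) →ₗ[R] R :=
  x ^ 2 • LinearMap.proj 0 + (x * y) • LinearMap.proj 1 + y ^ 2 • LinearMap.proj 2

@[simp]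
lemma quadFunctional_apply (x y : R) (v : Fin 3 → R) :
    quadFunctional x y v = x ^ 2 * v 0 + x * y * v 1 + y ^ 2 * v 2 := rfl

/-- The combination with coefficients `a`, `b` of the two Koszul relations between `x ^ 2`,
`x * y`, `y ^ 2`. -/
def koszul (x y a b : R) : Fin 3 → R := ![a * y, b * y - a * x, -(b * x)]

lemma quadFunctional_koszul (x y a b : R) : quadFunctional x y (koszul x y a b) = 0 := by
  simp [koszul]; ring

lemma tripleDet_koszul (x y a b c d : R) (v : Fin 3 → R) :
    tripleDet v (koszul x y a b) (koszul x y c d) = (a * d - b * c) * quadFunctional x y v := by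
  simp [koszul, tripleDet]; ring

lemma koszul_mem {A : Ideal R} {x y : R} (hx : x ∈ A) (hy : y ∈ A) (a b : R) (i : Fin 3) :
    koszul x y a b i ∈ A := by
  fin_cases i
  · exact A.mul_mem_left _ hy
  · exact sub_mem (A.mul_mem_left _ hy) (A.mul_mem_left _ hx)
  · exact neg_mem (A.mul_mem_left _ hx)

end TripleDet

section QuadModule

variable {R : Type*} [CommRing R]

/-- The vectors `v` such that `x ^ 2 * v 0 + x * y * v 1 + y ^ 2 * v 2 ∈ I`. -/
def quadModule (x y : R) (I : Ideal R) : Submodule R (Fin 3 → R) :=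
  Submodule.comap (quadFunctional x y) I

lemma mem_quadModule {x y : R} {I : Ideal R} {v : Fin 3 → R} :
    v ∈ quadModule x y I ↔ quadFunctional x y v ∈ I := Iff.rfl

lemma koszul_mem_quadModule (x y : R) (I : Ideal R) (a b : R) :
    koszul x y a b ∈ quadModule x y I := by
  rw [mem_quadModule, quadFunctional_koszul]
  exact I.zero_mem

lemma range_quadFunctional {x y : R} {A : Ideal R} (h : A = Ideal.span {x, y}) :
    LinearMap.range (quadFunctional x y) = A ^ 2 := by
  have hx : x ∈ A := h ▸ Ideal.subset_span (by simp)
  have hy : y ∈ A := h ▸ Ideal.subset_span (by simp)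
  apply le_antisymm
  · rintro _ ⟨v, rfl⟩
    rw [pow_two, quadFunctional_apply, pow_two, pow_two]
    exact add_mem (add_mem (Ideal.mul_mem_right _ _ (Ideal.mul_mem_mul hx hx))
      (Ideal.mul_mem_right _ _ (Ideal.mul_mem_mul hx hy)))
      (Ideal.mul_mem_right _ _ (Ideal.mul_mem_mul hy hy))
  · rw [pow_two, Ideal.mul_le]
    intro r hr s hs
    rw [h] at hr hs
    obtain ⟨a, b, rfl⟩ := Ideal.mem_span_pair.1 hr
    obtain ⟨c, d, rfl⟩ := Ideal.mem_span_pair.1 hs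
    exact ⟨![a * c, a * d + b * c, b * d], by simp; ring⟩

lemma modIntClosed_quadModule {x y : R} {I : Ideal R} (hI : IdealIntClosed I)
    (hM : maxMinors (quadModule x y I) = I) : ModIntClosed (quadModule x y I) := by
  intro v hv
  have h1 := hv.memIntClosure_tripleDet (koszul_mem_quadModule x y I 1 0)
    (koszul_mem_quadModule x y I 0 1)
  rw [tripleDet_koszul, hM] at h1
  exact mem_quadModule.2 (by simpa using hI _ h1)

lemma mapQ_comap_injective {M N : Type*} [AddCommGroup M] [AddCommGroup N] [Module R M]
    [Module R N] (f : M →ₗ[R] N) (q : Submodule R N) :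
    Function.Injective (Submodule.mapQ (q.comap f) q f le_rfl) := by
  rw [← LinearMap.ker_eq_bot, Submodule.ker_mapQ, Submodule.mkQ_map_self]

variable [IsLocalRing R]

lemma mem_maximalIdeal_of_mem_quadModule (hreg : IsTwoDimRegularLocal R) [IsDomain R] {x y : R}
    (h : maximalIdeal R = Ideal.span {x, y}) {v : Fin 3 → R}
    (hv : v ∈ quadModule x y (maximalIdeal R ^ 3)) (i : Fin 3) : v i ∈ maximalIdeal R := by
  obtain ⟨h0, h1, h2⟩ := coeff_mem_of_quadratic_mem hreg h (a := v 0) (b := v 1) (c := v 2)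
    (by rw [mem_quadModule, quadFunctional_apply] at hv; convert hv using 1; ring)
  fin_cases i <;> assumption

lemma maxMinors_quadModule (hreg : IsTwoDimRegularLocal R) [IsDomain R] {x y : R}
    (h : maximalIdeal R = Ideal.span {x, y}) {I : Ideal R} (hI : IdealIntClosed I)
    (hle : I ≤ maximalIdeal R ^ 3) : maxMinors (quadModule x y I) = I := by
  apply le_antisymm
  · rw [maxMinors_le_iff]
    intro u hu v hv w hw
    refine hI.mem_of_forall_mul_mem hreg 2 fun m hm => ?_
    rw [← range_quadFunctional h] at hm
    obtain ⟨f, rfl⟩ := hm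
    have key {v w : Fin 3 → R} (hv : v ∈ quadModule x y I) (hw : w ∈ quadModule x y I) :
        tripleDet f v w ∈ maximalIdeal R ^ 2 :=
      tripleDet_mem_sq (mem_maximalIdeal_of_mem_quadModule hreg h (hle hv))
        (mem_maximalIdeal_of_mem_quadModule hreg h (hle hw))
    rw [tripleDet_mul_apply]
    exact add_mem (sub_mem (Ideal.mul_mem_mul hu (key hv hw)) (Ideal.mul_mem_mul hv (key hu hw)))
      (Ideal.mul_mem_mul hw (key hu hv))
  · intro a ha
    have h1 := Ideal.pow_le_pow_right (by norm_num : 2 ≤ 3) (hle ha)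
    rw [← range_quadFunctional h] at h1
    obtain ⟨v, rfl⟩ := h1
    have h2 := tripleDet_mem_maxMinors (M := quadModule x y I) (mem_quadModule.2 ha)
      (koszul_mem_quadModule x y I 1 0) (koszul_mem_quadModule x y I 0 1)
    rw [tripleDet_koszul] at h2
    simpa using h2

lemma exists_pow_le_of_isMPrimary [IsNoetherianRing R] {I : Ideal R} (hI : IsMPrimary I) :
    ∃ k, maximalIdeal R ^ k ≤ I := by
  rw [← hI]
  exact Ideal.exists_radical_pow_le_of_fg I (IsNoetherian.noetherian _)

lemma isMPrimary_of_pow_le {I : Ideal R} {k : ℕ} (hk : maximalIdeal R ^ k ≤ I)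
    (hI : I ≤ maximalIdeal R) : IsMPrimary I := by
  refine le_antisymm ((maximalIdeal.isMaximal R).isPrime.radical_le_iff.2 hI) fun z hz => ?_
  exact ⟨k, hk (Ideal.pow_mem_pow hz k)⟩

lemma isFiniteLength_quotient_of_pow_le [IsNoetherianRing R] {I : Ideal R} {k : ℕ}
    (hk : maximalIdeal R ^ k ≤ I) : IsFiniteLength R (R ⧸ I) := by
  rw [isFiniteLength_iff_isNoetherian_isArtinian]
  refine ⟨inferInstance, ?_⟩
  rcases eq_or_ne I ⊤ with rfl | hI
  · have : Subsingleton (R ⧸ (⊤ : Ideal R)) := Ideal.Quotient.subsingleton_iff.2 rfl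
    infer_instance
  have : Nontrivial (R ⧸ I) := Ideal.Quotient.nontrivial_iff.2 hI
  have hsurj : Function.Surjective (Ideal.Quotient.mk I) := Ideal.Quotient.mk_surjective
  have : IsLocalRing (R ⧸ I) := IsLocalRing.of_surjective' _ hsurj
  have : IsArtinianRing (R ⧸ I) := by
    rw [isArtinianRing_iff_isNilpotent_maximalIdeal]
    refine ⟨k, ?_⟩
    rw [← IsLocalRing.map_maximalIdeal_of_surjective _ hsurj, ← Ideal.map_pow, Ideal.zero_eq_bot,
      Ideal.map_eq_bot_iff_le_ker, Ideal.mk_ker]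
    exact hk
  exact isArtinian_of_surjective_algebraMap (R := R ⧸ I) hsurj

lemma finColength_quadModule [IsNoetherianRing R] {x y : R} {I : Ideal R} {k : ℕ}
    (hk : maximalIdeal R ^ k ≤ I) : FinColength (quadModule x y I) := by
  have h1 := isFiniteLength_quotient_of_pow_le hk
  rw [FinColength]
  rw [isFiniteLength_iff_isNoetherian_isArtinian] at h1 ⊢
  have := h1.2
  exact ⟨inferInstance, isArtinian_of_injective _ (mapQ_comap_injective (quadFunctional x y) I)⟩

end QuadModule

section QuadSplitting

variable {R : Type*} [CommRing R]

lemma tripleDet_mul_tripleDet (f u t v w : Fin 3 → R) :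
    tripleDet f v w * tripleDet f u t =
      tripleDet f v t * tripleDet f u w - tripleDet f w t * tripleDet f u v := by
  simp only [tripleDet]
  ring

/-- A splitting of `quadModule x y I`, given by a vector `f` and a functional `c`, together with
normalised parameters putting the Koszul relations in general position with respect to `f`. -/
structure QuadSplitting (x y : R) (I : Ideal R) where
  f : Fin 3 → R
  c : (Fin 3 → R) →ₗ[R] R
  (a b a' b' : R)
  apply_f : c f = 1
  smul_mem : ∀ v ∈ quadModule x y I, c v • f ∈ quadModule x y I
  det_eq_one : a * b' - b * a' = 1
  disc_eq_one : tripleDet f ![a, b, 0] ![0, -a, -b] = 1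

namespace QuadSplitting

variable {x y : R} {I : Ideal R} (s : QuadSplitting x y I)

/-- The first vector complementing `s.f` to a basis. -/
def u : Fin 3 → R := ![s.a, s.b, 0]

/-- The second vector complementing `s.f` to a basis. -/
def t : Fin 3 → R := ![0, -s.a, -s.b]

/-- The distinguished Koszul relation. -/
def w : Fin 3 → R := koszul x y s.a s.b

/-- The functional cutting out the span of `s.f` and `s.w`. -/
def psi : (Fin 3 → R) →ₗ[R] R := tripleDetRight s.f s.w

/-- The first ideal factor of `I` attached to the splitting. -/
def J : Ideal R := Submodule.comap (LinearMap.toSpanSingleton R (Fin 3 → R) s.f) (quadModule x y I)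

/-- The second ideal factor of `I` attached to the splitting. -/
def K : Ideal R := Submodule.map s.psi (quadModule x y I)

/-- A second Koszul relation, spanning all of them together with `s.w`. -/
def w' : Fin 3 → R := koszul x y s.a' s.b'

lemma mem_J {r : R} : r ∈ s.J ↔ r • s.f ∈ quadModule x y I := Iff.rfl

lemma mem_J_iff {r : R} : r ∈ s.J ↔ r * quadFunctional x y s.f ∈ I := by
  rw [mem_J, mem_quadModule, map_smul, smul_eq_mul]

lemma apply_mem_J {v : Fin 3 → R} (hv : v ∈ quadModule x y I) : s.c v ∈ s.J := s.smul_mem v hv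

lemma psi_apply (v : Fin 3 → R) : s.psi v = tripleDet s.f s.w v := rfl

lemma psi_mem_K {v : Fin 3 → R} (hv : v ∈ quadModule x y I) : s.psi v ∈ s.K := ⟨v, hv, rfl⟩

lemma w_mem : s.w ∈ quadModule x y I := koszul_mem_quadModule ..

lemma w'_mem : s.w' ∈ quadModule x y I := koszul_mem_quadModule ..

lemma psi_eq (v : Fin 3 → R) :
    s.psi v = y * tripleDet s.f s.u v - x * tripleDet s.f v s.t := by
  simp [psi_apply, w, u, t, koszul, tripleDet]
  ring

lemma smul_psi_add (p q : R) : s.psi (q • s.t - p • s.u) = p * x + q * y := by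
  have h := s.disc_eq_one
  simp [psi_apply, w, u, t, koszul, tripleDet] at h ⊢
  linear_combination (p * x + q * y) * h

lemma psi_f : s.psi s.f = 0 := by
  simp only [psi_apply, tripleDet]; ring

lemma smul_eq (v : Fin 3 → R) :
    v = tripleDet v s.u s.t • s.f + tripleDet s.f v s.t • s.u + tripleDet s.f s.u v • s.t := by
  rw [← tripleDet_smul_eq, show tripleDet s.f s.u s.t = 1 from s.disc_eq_one, one_smul]

lemma tripleDet_eq (v w : Fin 3 → R) :
    tripleDet s.f v w =
      tripleDet s.f v s.t * tripleDet s.f s.u w - tripleDet s.f w s.t * tripleDet s.f s.u v := by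
  rw [← tripleDet_mul_tripleDet, show tripleDet s.f s.u s.t = 1 from s.disc_eq_one, mul_one]

lemma left_mul_tripleDet (v w : Fin 3 → R) : x * tripleDet s.f v w =
    tripleDet s.f s.u v * s.psi w - tripleDet s.f s.u w * s.psi v := by
  rw [tripleDet_eq, psi_eq, psi_eq]; ring

lemma right_mul_tripleDet (v w : Fin 3 → R) : y * tripleDet s.f v w =
    tripleDet s.f v s.t * s.psi w - tripleDet s.f w s.t * s.psi v := by
  rw [tripleDet_eq, psi_eq, psi_eq]; ring

lemma tripleDet_w_w' (v : Fin 3 → R) : tripleDet v s.w s.w' = quadFunctional x y v := by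
  rw [w, w', tripleDet_koszul, s.det_eq_one, one_mul]

lemma tripleDet_expand (u v w : Fin 3 → R) : tripleDet u v w =
    s.c u * tripleDet s.f v w - s.c v * tripleDet s.f u w + s.c w * tripleDet s.f u v := by
  rw [← tripleDet_mul_apply, s.apply_f, mul_one]

lemma quadFunctional_eq (v : Fin 3 → R) : quadFunctional x y v =
    s.c v * s.psi s.w' - s.c s.w * tripleDet s.f v s.w' + s.c s.w' * tripleDet s.f v s.w := by
  rw [← tripleDet_w_w', tripleDet_expand, psi_apply]

lemma J_mul_K_le (hM : maxMinors (quadModule x y I) = I) : s.J * s.K ≤ I := by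
  rw [Ideal.mul_le]
  rintro j hj _ ⟨v, hv, rfl⟩
  have h := tripleDet_mem_maxMinors (s.mem_J.1 hj) s.w_mem hv
  rw [hM] at h
  convert h using 1
  simp [psi_apply, tripleDet]; ring

lemma idealIntClosed_J (hI : IdealIntClosed I) : IdealIntClosed s.J := fun _ hz =>
  s.mem_J_iff.2 (hI _ (hz.mul_of_forall_mul_mem fun _ hj => s.mem_J_iff.1 hj))

variable [IsLocalRing R]

lemma mul_tripleDet_mem (h : maximalIdeal R = Ideal.span {x, y}) {A : Ideal R} {v w : Fin 3 → R}
    {r : R} (hv : r * s.psi v ∈ A) (hw : r * s.psi w ∈ A) (hvm : ∀ i, v i ∈ maximalIdeal R)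
    (hwm : ∀ i, w i ∈ maximalIdeal R) {m : R} (hm : m ∈ maximalIdeal R) :
    r * tripleDet s.f v w * m ∈ A * maximalIdeal R := by
  rw [h] at hm
  obtain ⟨p, q, rfl⟩ := Ideal.mem_span_pair.1 hm
  have e : r * tripleDet s.f v w * (p * x + q * y) =
      p * (r * s.psi w * tripleDet s.f s.u v - r * s.psi v * tripleDet s.f s.u w) +
      q * (r * s.psi w * tripleDet s.f v s.t - r * s.psi v * tripleDet s.f w s.t) := by
    linear_combination p * r * s.left_mul_tripleDet v w + q * r * s.right_mul_tripleDet v w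
  rw [e]
  refine add_mem (Ideal.mul_mem_left _ _ (sub_mem ?_ ?_)) (Ideal.mul_mem_left _ _ (sub_mem ?_ ?_))
  · exact Ideal.mul_mem_mul hw (tripleDet_mem_of_right hvm)
  · exact Ideal.mul_mem_mul hv (tripleDet_mem_of_right hwm)
  · exact Ideal.mul_mem_mul hw (tripleDet_mem_of_middle hvm)
  · exact Ideal.mul_mem_mul hv (tripleDet_mem_of_middle hwm)

end QuadSplitting

lemma nonempty_quadSplitting_of_isUnit {x y : R} {I : Ideal R} {f : Fin 3 → R}
    {c : (Fin 3 → R) →ₗ[R] R} (hf : c f = 1)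
    (hM : ∀ v ∈ quadModule x y I, c v • f ∈ quadModule x y I) {a b a' b' : R}
    (hd : a * b' - b * a' = 1) (hu : IsUnit (tripleDet f ![a, b, 0] ![0, -a, -b])) :
    Nonempty (QuadSplitting x y I) := by
  obtain ⟨e, he⟩ := hu.exists_left_inv
  have he2 : tripleDet (e • f) ![a, b, 0] ![0, -a, -b] = 1 := by
    rw [← he]
    simp only [tripleDet, Pi.smul_apply, smul_eq_mul]; ring
  refine ⟨e • f, tripleDet f ![a, b, 0] ![0, -a, -b] • c, a, b, a', b', ?_, fun v hv => ?_, hd, he2⟩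
  · simp only [LinearMap.smul_apply, map_smul, hf, smul_eq_mul]
    linear_combination he
  · convert hM v hv using 1
    rw [LinearMap.smul_apply, smul_smul, smul_eq_mul]
    congr 1
    linear_combination c v * he

lemma nonempty_quadSplitting [IsLocalRing R] {x y : R} {I : Ideal R} {f : Fin 3 → R}
    {c : (Fin 3 → R) →ₗ[R] R} (hf : c f = 1)
    (hM : ∀ v ∈ quadModule x y I, c v • f ∈ quadModule x y I) :
    Nonempty (QuadSplitting x y I) := by
  by_cases h2 : f 2 ∈ maximalIdeal R
  · by_cases h0 : f 0 ∈ maximalIdeal R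
    · refine nonempty_quadSplitting_of_isUnit hf hM (a := 1) (b := 1) (a' := 0) (b' := 1) (by ring)
        (isUnit_of_notMem_maximalIdeal fun h => ?_)
      have h1 : f 1 ∈ maximalIdeal R := by
        convert add_mem h (add_mem h0 h2) using 1
        simp [tripleDet]; ring
      refine notMem_maximalIdeal_of_isUnit isUnit_one (hf ▸ c.apply_mem_of_forall_mem ?_)
      intro i; fin_cases i <;> assumption
    · refine nonempty_quadSplitting_of_isUnit hf hM (a := 0) (b := 1) (a' := -1) (b' := 0) (by ring)
        (isUnit_of_notMem_maximalIdeal fun h => h0 ?_)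
      simpa [tripleDet] using h
  · refine nonempty_quadSplitting_of_isUnit hf hM (a := 1) (b := 0) (a' := 0) (b' := 1) (by ring)
      (isUnit_of_notMem_maximalIdeal fun h => h2 ?_)
    simpa [tripleDet] using h

end QuadSplitting

section Factorization

variable {R : Type*} [CommRing R] [IsLocalRing R]

namespace QuadSplitting

variable {x y : R} {I : Ideal R} (s : QuadSplitting x y I)

lemma psi_mem_sq (h : maximalIdeal R = Ideal.span {x, y}) {v : Fin 3 → R}
    (hv : ∀ i, v i ∈ maximalIdeal R) : s.psi v ∈ maximalIdeal R ^ 2 :=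
  tripleDet_mem_sq (koszul_mem (left_mem_maximalIdeal h) (right_mem_maximalIdeal h) _ _) hv

lemma psi_mem_maximalIdeal (h : maximalIdeal R = Ideal.span {x, y}) (v : Fin 3 → R) :
    s.psi v ∈ maximalIdeal R :=
  tripleDet_mem_of_middle (koszul_mem (left_mem_maximalIdeal h) (right_mem_maximalIdeal h) _ _)

lemma exists_psi_eq (h : maximalIdeal R = Ideal.span {x, y}) {z : R} (hz : z ∈ maximalIdeal R) :
    ∃ v, s.psi v = z := by
  rw [h] at hz
  obtain ⟨p, q, rfl⟩ := Ideal.mem_span_pair.1 hz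
  exact ⟨_, s.smul_psi_add p q⟩

variable [IsDomain R]

lemma mem_maximalIdeal (hreg : IsTwoDimRegularLocal R)
    (h : maximalIdeal R = Ideal.span {x, y})
    (hle : I ≤ maximalIdeal R ^ 3) {v : Fin 3 → R} (hv : v ∈ quadModule x y I) (i : Fin 3) :
    v i ∈ maximalIdeal R :=
  mem_maximalIdeal_of_mem_quadModule hreg h (hle hv) i

lemma J_le (hreg : IsTwoDimRegularLocal R) (h : maximalIdeal R = Ideal.span {x, y})
    (hle : I ≤ maximalIdeal R ^ 3) : s.J ≤ maximalIdeal R := by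
  intro r hr
  have h1 := s.c.apply_mem_of_forall_mem (mem_maximalIdeal hreg h hle (s.mem_J.1 hr))
  simpa [s.apply_f] using h1

lemma K_le (hreg : IsTwoDimRegularLocal R) (h : maximalIdeal R = Ideal.span {x, y})
    (hle : I ≤ maximalIdeal R ^ 3) : s.K ≤ maximalIdeal R ^ 2 := by
  rintro _ ⟨v, hv, rfl⟩
  exact s.psi_mem_sq h (mem_maximalIdeal hreg h hle hv)

lemma idealIntClosed_K (hreg : IsTwoDimRegularLocal R) (h : maximalIdeal R = Ideal.span {x, y})
    (hI : IdealIntClosed I) (hle : I ≤ maximalIdeal R ^ 3) : IdealIntClosed s.K := by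
  intro z hz
  have hM := maxMinors_quadModule hreg h hI hle
  have hz2 := mem_sq_of_memIntClosure hreg (s.K_le hreg h hle) hz
  rw [pow_two, mem_maximalIdeal_mul_iff h] at hz2
  obtain ⟨p, hp, q, hq, e⟩ := hz2
  have hzJ : ∀ j ∈ s.J, j * z ∈ I := fun j hj => by
    rw [mul_comm]
    refine hI _ (hz.mul_of_forall_mul_mem fun k hk => s.J_mul_K_le hM ?_)
    rw [mul_comm]
    exact Ideal.mul_mem_mul hk hj
  let v₀ := q • s.t - p • s.u
  let v := v₀ - s.c v₀ • s.f
  have hv₀m : ∀ i, v₀ i ∈ maximalIdeal R := fun i =>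
    sub_mem (Ideal.mul_mem_right _ _ hq) (Ideal.mul_mem_right _ _ hp)
  have hvm : ∀ i, v i ∈ maximalIdeal R := fun i =>
    sub_mem (hv₀m i) (Ideal.mul_mem_right _ _ (s.c.apply_mem_of_forall_mem hv₀m))
  have hcv : s.c v = 0 := by simp [v, s.apply_f]
  have hpv : s.psi v = z := by
    rw [map_sub, map_smul, s.psi_f, s.smul_psi_add, e]; simp; ring
  have key : ∀ j ∈ s.J, ∀ w ∈ quadModule x y I, j * tripleDet s.f v w ∈ I := by
    intro j hj w hw
    refine hI.mem_of_forall_mul_mem hreg 1 fun m hm => ?_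
    rw [pow_one] at hm ⊢
    refine s.mul_tripleDet_mem h ?_ ?_ hvm (mem_maximalIdeal hreg h hle hw) hm
    · rw [hpv]; exact hzJ j hj
    · exact s.J_mul_K_le hM (Ideal.mul_mem_mul hj (s.psi_mem_K hw))
  refine ⟨v, modIntClosed_quadModule hI hM v (integralOverMod_of_forall_tripleDet ?_), hpv⟩
  intro u hu w hw
  rw [hM, s.tripleDet_expand, hcv, zero_mul, zero_sub]
  exact add_mem (neg_mem (key _ (s.apply_mem_J hu) w hw)) (key _ (s.apply_mem_J hw) u hu)

lemma tripleDet_mem_K (hreg : IsTwoDimRegularLocal R) (h : maximalIdeal R = Ideal.span {x, y})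
    (hI : IdealIntClosed I) (hle : I ≤ maximalIdeal R ^ 3) {v w : Fin 3 → R}
    (hv : v ∈ quadModule x y I) (hw : w ∈ quadModule x y I) : tripleDet s.f v w ∈ s.K := by
  refine (s.idealIntClosed_K hreg h hI hle).mem_of_forall_mul_mem hreg 1 fun m hm => ?_
  rw [pow_one] at hm ⊢
  have h1 := s.mul_tripleDet_mem (r := 1) (A := s.K) h (by simpa using s.psi_mem_K hv)
    (by simpa using s.psi_mem_K hw) (mem_maximalIdeal hreg h hle hv)
    (mem_maximalIdeal hreg h hle hw) hm
  rwa [one_mul] at h1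

lemma J_mul_K (hreg : IsTwoDimRegularLocal R) (h : maximalIdeal R = Ideal.span {x, y})
    (hI : IdealIntClosed I) (hle : I ≤ maximalIdeal R ^ 3) : I = s.J * s.K := by
  have hM := maxMinors_quadModule hreg h hI hle
  refine le_antisymm ?_ (s.J_mul_K_le hM)
  conv_lhs => rw [← hM]
  rw [maxMinors_le_iff]
  intro u hu v hv w hw
  rw [s.tripleDet_expand]
  have key {u v w} (hu : u ∈ quadModule x y I) (hv : v ∈ quadModule x y I)
      (hw : w ∈ quadModule x y I) : s.c u * tripleDet s.f v w ∈ s.J * s.K :=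
    Ideal.mul_mem_mul (s.apply_mem_J hu) (s.tripleDet_mem_K hreg h hI hle hv hw)
  exact add_mem (sub_mem (key hu hv hw) (key hv hu hw)) (key hw hu hv)

lemma sq_eq (hreg : IsTwoDimRegularLocal R) (h : maximalIdeal R = Ideal.span {x, y})
    (hle : I ≤ maximalIdeal R ^ 3) : maximalIdeal R ^ 2 = maximalIdeal R * s.J + s.K := by
  apply le_antisymm
  · rw [← range_quadFunctional h]
    rintro _ ⟨v, rfl⟩
    have key {w w'} (hw : w ∈ quadModule x y I) (hw' : w' ∈ quadModule x y I) :
        s.c w * tripleDet s.f v w' ∈ maximalIdeal R * s.J := by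
      rw [mul_comm]
      exact Ideal.mul_mem_mul (s.apply_mem_J hw)
        (tripleDet_mem_of_right (mem_maximalIdeal hreg h hle hw'))
    rw [s.quadFunctional_eq]
    refine add_mem (sub_mem ?_ ?_) ?_
    · exact Ideal.mem_sup_right (Ideal.mul_mem_left _ _ (s.psi_mem_K s.w'_mem))
    · exact Ideal.mem_sup_left (key s.w_mem s.w'_mem)
    · exact Ideal.mem_sup_left (key s.w'_mem s.w_mem)
  · rw [pow_two]
    refine sup_le (Ideal.mul_mono_right (s.J_le hreg h hle)) ?_
    rw [← pow_two]
    exact s.K_le hreg h hle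

lemma not_J_le (hreg : IsTwoDimRegularLocal R) (h : maximalIdeal R = Ideal.span {x, y})
    (hle : I ≤ maximalIdeal R ^ 3) : ¬ s.J ≤ maximalIdeal R ^ 2 := by
  intro hJ
  let e := s.u - s.c s.u • s.f
  have hce : s.c e = 0 := by simp [e, s.apply_f]
  have h1 : quadFunctional x y e ∈ maximalIdeal R ^ 3 := by
    have key {w w'} (hw : w ∈ quadModule x y I) (hw' : w' ∈ quadModule x y I) :
        s.c w * tripleDet s.f e w' ∈ maximalIdeal R ^ 3 := by
      rw [pow_succ]
      exact Ideal.mul_mem_mul (hJ (s.apply_mem_J hw))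
        (tripleDet_mem_of_right (mem_maximalIdeal hreg h hle hw'))
    rw [s.quadFunctional_eq, hce, zero_mul, zero_sub]
    exact add_mem (neg_mem (key s.w_mem s.w'_mem)) (key s.w'_mem s.w_mem)
  have h2 : tripleDet s.f e s.t ∈ maximalIdeal R :=
    tripleDet_mem_of_middle (mem_maximalIdeal_of_mem_quadModule hreg h h1)
  refine notMem_maximalIdeal_of_isUnit (isUnit_one (M := R)) ?_
  rw [← s.disc_eq_one]
  convert h2 using 1
  simp only [tripleDet, e, Pi.sub_apply, Pi.smul_apply, smul_eq_mul, u, t]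
  ring

lemma not_K_le (hreg : IsTwoDimRegularLocal R) (h : maximalIdeal R = Ideal.span {x, y}) :
    ¬ s.K ≤ maximalIdeal R ^ 3 := by
  intro hK
  have h1 : quadFunctional x y s.f ∈ maximalIdeal R ^ 3 := by
    rw [← s.tripleDet_w_w']
    exact hK (s.psi_mem_K s.w'_mem)
  have h2 := s.c.apply_mem_of_forall_mem (mem_maximalIdeal_of_mem_quadModule hreg h h1)
  rw [s.apply_f] at h2
  exact notMem_maximalIdeal_of_isUnit isUnit_one h2

lemma not_le (s : QuadSplitting x y I) (hreg : IsTwoDimRegularLocal R)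
    (h : maximalIdeal R = Ideal.span {x, y}) (hI : IdealIntClosed I)
    (hle : I ≤ maximalIdeal R ^ 3) : ¬ I ≤ maximalIdeal R ^ 4 := by
  intro hI4
  obtain ⟨j, hj, hj2⟩ := SetLike.not_le_iff_exists.1 (s.not_J_le hreg h hle)
  obtain ⟨k, hk, hk3⟩ := SetLike.not_le_iff_exists.1 (s.not_K_le hreg h)
  refine hk3 (mem_pow_of_mul_mem hreg (s.J_le hreg h hle hj) hj2 (hI4 ?_))
  rw [s.J_mul_K hreg h hI hle]
  exact Ideal.mul_mem_mul hj hk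

end QuadSplitting

end Factorization

section Length

variable {R : Type*} [CommRing R]

lemma length_quotient_eq_comap_add {M N : Type*} [AddCommGroup M] [AddCommGroup N] [Module R M]
    [Module R N] (f : M →ₗ[R] N) (q : Submodule R N) : Module.length R (N ⧸ q) =
      Module.length R (M ⧸ q.comap f) + Module.length R (N ⧸ (LinearMap.range f ⊔ q)) := by
  refine Module.length_eq_add_of_exact _ (Submodule.factor (le_sup_right : q ≤ _))
    (mapQ_comap_injective f q) (Submodule.factor_surjective _) ?_
  rw [LinearMap.exact_iff, Submodule.factor, Submodule.ker_mapQ, Submodule.range_mapQ,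
    Submodule.comap_id, Submodule.map_sup, Submodule.mkQ_map_self, sup_bot_eq]

lemma length_quotient_top {N : Type*} [AddCommGroup N] [Module R N] :
    Module.length R (N ⧸ (⊤ : Submodule R N)) = 0 := by
  rw [Module.length_eq_zero_iff]
  infer_instance

lemma length_quotient_prod (A B : Ideal R) : Module.length R ((R × R) ⧸ Submodule.prod A B) =
    Module.length R (R ⧸ A) + Module.length R (R ⧸ B) := by
  have h1 : Submodule.comap (LinearMap.inl R R R) (Submodule.prod A B) = A := by
    ext; simp
  have h2 : LinearMap.range (LinearMap.inl R R R) ⊔ Submodule.prod A B = Submodule.prod ⊤ B := by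
    refine le_antisymm (sup_le ?_ (Submodule.prod_mono le_top le_rfl)) ?_
    · rintro _ ⟨a, rfl⟩
      simp
    · rintro ⟨a, b⟩ ⟨-, hb⟩
      exact Submodule.mem_sup.2 ⟨(a, 0), ⟨a, rfl⟩, (0, b), ⟨A.zero_mem, hb⟩, by simp⟩
  have h3 : Submodule.comap (LinearMap.inr R R R) (Submodule.prod ⊤ B) = B := by
    ext; simp
  have h4 : LinearMap.range (LinearMap.inr R R R) ⊔ Submodule.prod ⊤ B = ⊤ := by
    rw [eq_top_iff]
    rintro ⟨a, b⟩ -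
    exact Submodule.mem_sup.2 ⟨(0, b), ⟨b, rfl⟩, (a, 0), ⟨trivial, B.zero_mem⟩, by simp⟩
  rw [length_quotient_eq_comap_add (LinearMap.inl R R R), h1, h2,
    length_quotient_eq_comap_add (LinearMap.inr R R R), h3, h4, length_quotient_top, add_zero]

variable [IsLocalRing R]

lemma length_quotient_maximalIdeal : Module.length R (R ⧸ maximalIdeal R) = 1 := by
  rw [Module.length_eq_one_iff]
  exact isSimpleModule_iff_isCoatom.2 (maximalIdeal.isMaximal R).out

lemma length_quotient_eq_add_one {A B : Ideal R} {b : R}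
    (hB : B = Ideal.span {b} ⊔ A) (hb : b ∉ A) (hm : ∀ m ∈ maximalIdeal R, m * b ∈ A) :
    Module.length R (R ⧸ A) = 1 + Module.length R (R ⧸ B) := by
  have hker : Submodule.comap (LinearMap.toSpanSingleton R R b) A = maximalIdeal R := by
    refine ((maximalIdeal.isMaximal R).eq_of_le ?_ hm).symm
    intro h1
    have h2 := (h1 ▸ Submodule.mem_top : (1 : R) ∈ Submodule.comap _ A)
    exact hb (by simpa using h2)
  rw [length_quotient_eq_comap_add (LinearMap.toSpanSingleton R R b), hker,
    length_quotient_maximalIdeal, LinearMap.range_toSpanSingleton, hB]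

lemma length_quotient_sq (hreg : IsTwoDimRegularLocal R) :
    Module.length R (R ⧸ maximalIdeal R ^ 2) = 3 := by
  obtain ⟨x, y, h⟩ := hreg.2.2
  have hx := left_mem_maximalIdeal h
  have hy := right_mem_maximalIdeal h
  have h2 : Module.length R (R ⧸ (Ideal.span {x} ⊔ maximalIdeal R ^ 2)) =
      1 + Module.length R (R ⧸ maximalIdeal R) := by
    refine length_quotient_eq_add_one (b := y) ?_ ?_ fun m hm => ?_
    · apply le_antisymm
      · rw [sup_left_comm, ← sup_assoc, ← Ideal.span_insert, ← h]
        exact le_sup_left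
      · refine sup_le ?_ (sup_le ?_ (Ideal.pow_le_self two_ne_zero))
        · exact (Ideal.span_singleton_le_iff_mem _).2 hy
        · exact (Ideal.span_singleton_le_iff_mem _).2 hx
    · intro hy2
      obtain ⟨n, hn, m, hm, e⟩ := Submodule.mem_sup.1 hy2
      obtain ⟨r, rfl⟩ := Ideal.mem_span_singleton'.1 hn
      refine notMem_maximalIdeal_of_isUnit (isUnit_one (M := R))
        (mem_maximalIdeal_of_mul_pow_eq hreg h (k := 1) hm (s := r) ?_)
      linear_combination -e
    · exact Ideal.mem_sup_right (by rw [pow_two]; exact Ideal.mul_mem_mul hm hy)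
  have h3 : Module.length R (R ⧸ maximalIdeal R ^ 2) =
      1 + Module.length R (R ⧸ (Ideal.span {x} ⊔ maximalIdeal R ^ 2)) := by
    refine length_quotient_eq_add_one rfl ?_ fun m hm => ?_
    · intro hx2
      refine notMem_maximalIdeal_of_isUnit (isUnit_one (M := R))
        (mem_maximalIdeal_of_mul_pow_eq hreg (maximalIdeal_eq_span_swap h) (k := 1) hx2 (s := 0) ?_)
      ring
    · rw [pow_two]; exact Ideal.mul_mem_mul hm hx
  rw [h3, h2, length_quotient_maximalIdeal]; rfl

namespace QuadSplitting

variable {x y : R} {I : Ideal R} (s : QuadSplitting x y I)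

lemma exists_eq_add_of_psi_eq_zero (hreg : IsTwoDimRegularLocal R) [IsDomain R]
    (h : maximalIdeal R = Ideal.span {x, y}) {v : Fin 3 → R} (hv : s.psi v = 0) :
    ∃ p q : R, v = p • s.f + q • s.w := by
  have h1 : y * tripleDet s.f s.u v = x * tripleDet s.f v s.t := by
    rw [psi_eq] at hv
    exact sub_eq_zero.1 hv
  have h2 : tripleDet s.f s.u v ∈ Ideal.span {x} := by
    refine isPrime_pair hreg h (k := 1) ?_
    rw [pow_one, h1]
    exact Ideal.mul_mem_right _ _ (Ideal.mem_span_singleton_self x)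
  obtain ⟨q, hq⟩ := Ideal.mem_span_singleton.1 h2
  have h3 : tripleDet s.f v s.t = y * q := by
    apply mul_left_cancel₀ (ne_zero_of_maximalIdeal_eq hreg h)
    rw [← h1, hq]; ring
  refine ⟨tripleDet v s.u s.t, q, ?_⟩
  conv_lhs => rw [s.smul_eq v, hq, h3]
  rw [add_assoc]
  congr 1
  ext i
  fin_cases i <;> simp [u, t, w, koszul] <;> ring

lemma comap_prod_psi (hreg : IsTwoDimRegularLocal R) [IsDomain R]
    (h : maximalIdeal R = Ideal.span {x, y}) :
    Submodule.comap (s.c.prod s.psi) (Submodule.prod s.J s.K) = quadModule x y I := by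
  ext v
  constructor
  · rintro ⟨hc, w, hw, hwv : s.psi w = s.psi v⟩
    obtain ⟨p, q, e⟩ := s.exists_eq_add_of_psi_eq_zero hreg h (v := v - w)
      (by rw [map_sub, hwv, sub_self])
    have h1 : s.c v - s.c w - q * s.c s.w = p := by
      rw [← map_sub, e]; simp [s.apply_f]
    have h2 : p ∈ s.J :=
      h1 ▸ sub_mem (sub_mem hc (s.apply_mem_J hw)) (Ideal.mul_mem_left _ _ (s.apply_mem_J s.w_mem))
    rw [sub_eq_iff_eq_add.1 e]
    exact add_mem (add_mem h2 (Submodule.smul_mem _ _ s.w_mem)) hw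
  · exact fun hv => ⟨s.apply_mem_J hv, s.psi_mem_K hv⟩

lemma range_prod_psi (h : maximalIdeal R = Ideal.span {x, y}) (hK : s.K ≤ maximalIdeal R) :
    LinearMap.range (s.c.prod s.psi) ⊔ Submodule.prod s.J s.K =
      Submodule.prod ⊤ (maximalIdeal R) := by
  apply le_antisymm
  · refine sup_le ?_ (Submodule.prod_mono le_top hK)
    rintro _ ⟨v, rfl⟩
    exact ⟨trivial, s.psi_mem_maximalIdeal h v⟩
  · rintro ⟨a, b⟩ ⟨-, hb⟩
    obtain ⟨v, rfl⟩ := s.exists_psi_eq h hb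
    refine Submodule.mem_sup_left ⟨v + (a - s.c v) • s.f, ?_⟩
    simp [s.apply_f, s.psi_f]

lemma length_quotient (hreg : IsTwoDimRegularLocal R) [IsDomain R]
    (h : maximalIdeal R = Ideal.span {x, y}) (hle : I ≤ maximalIdeal R ^ 3) :
    Module.length R (R ⧸ I) = Module.length R (R ⧸ s.J) + Module.length R (R ⧸ s.K) + 2 := by
  have h1 := length_quotient_eq_comap_add (quadFunctional x y) I
  rw [range_quadFunctional h, sup_eq_left.2 (hle.trans (Ideal.pow_le_pow_right (by norm_num))),
    length_quotient_sq hreg] at h1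
  have h2 := length_quotient_eq_comap_add (s.c.prod s.psi) (Submodule.prod s.J s.K)
  rw [s.comap_prod_psi hreg h,
    s.range_prod_psi h ((s.K_le hreg h hle).trans (Ideal.pow_le_self two_ne_zero)),
    length_quotient_prod, length_quotient_prod, length_quotient_top, length_quotient_maximalIdeal,
    zero_add] at h2
  rw [h1, h2, add_assoc]
  rfl

end QuadSplitting

end Length

section Existence

variable {R : Type*} [CommRing R] [IsLocalRing R]

lemma exists_factorization_of_decomposableSub (hreg : IsTwoDimRegularLocal R) {x y : R}
    (h : maximalIdeal R = Ideal.span {x, y}) {I : Ideal R} (hI : IdealIntClosed I)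
    (hIp : IsMPrimary I) (hle : I ≤ maximalIdeal R ^ 3)
    (hD : DecomposableSub (quadModule x y I)) :
    ¬ I ≤ maximalIdeal R ^ 4 ∧ ∃ J K : Ideal R,
        IdealIntClosed J ∧ IsMPrimary J ∧ ordEQ J 1 ∧
        IdealIntClosed K ∧ IsMPrimary K ∧ ordEQ K 2 ∧
        I = J * K ∧
        modLength R (R ⧸ (J * K)) =
          modLength R (R ⧸ J) + modLength R (R ⧸ K) + ((2 : ℕ) : WithBot ℕ∞) ∧
        maximalIdeal R ^ 2 = maximalIdeal R * J + K := by
  have := hreg.1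
  have := isDomain_of_isTwoDimRegularLocal hreg
  obtain ⟨k, hk⟩ := exists_pow_le_of_isMPrimary hIp
  obtain ⟨f, c, hcf, hfM⟩ := hD.exists_splitting hreg (finColength_quadModule hk)
  obtain ⟨s⟩ := nonempty_quadSplitting hcf hfM
  have hJK := s.J_mul_K hreg h hI hle
  have hJ := s.J_le hreg h hle
  have hK := s.K_le hreg h hle
  refine ⟨s.not_le hreg h hI hle, s.J, s.K, s.idealIntClosed_J hI,
    isMPrimary_of_pow_le (hk.trans (hJK.le.trans Ideal.mul_le_left)) hJ,
    ⟨by simpa using hJ, s.not_J_le hreg h hle⟩, s.idealIntClosed_K hreg h hI hle,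
    isMPrimary_of_pow_le (hk.trans (hJK.le.trans Ideal.mul_le_right))
      (hK.trans (Ideal.pow_le_self two_ne_zero)),
    ⟨hK, s.not_K_le hreg h⟩, hJK, ?_, s.sq_eq hreg h hle⟩
  rw [← hJK]
  simp only [modLength, ← Module.coe_length]
  rw [s.length_quotient hreg h hle]
  rfl

lemma exists_indecomposableSub (hreg : IsTwoDimRegularLocal R) {I : Ideal R}
    (hI : IdealIntClosed I) (hIp : IsMPrimary I) (hle : I ≤ maximalIdeal R ^ 3)
    (hfac : ¬ I ≤ maximalIdeal R ^ 4 → ¬ ∃ J K : Ideal R,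
        IdealIntClosed J ∧ IsMPrimary J ∧ ordEQ J 1 ∧
        IdealIntClosed K ∧ IsMPrimary K ∧ ordEQ K 2 ∧
        I = J * K ∧
        modLength R (R ⧸ (J * K)) =
          modLength R (R ⧸ J) + modLength R (R ⧸ K) + ((2 : ℕ) : WithBot ℕ∞) ∧
        maximalIdeal R ^ 2 = maximalIdeal R * J + K) :
    ∃ M : Submodule R (Fin 3 → R),
      FinColength M ∧ ModIntClosed M ∧ IndecomposableSub M ∧ maxMinors M = I := by
  have := hreg.1
  have := isDomain_of_isTwoDimRegularLocal hreg
  obtain ⟨x, y, h⟩ := hreg.2.2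
  obtain ⟨k, hk⟩ := exists_pow_le_of_isMPrimary hIp
  have hM := maxMinors_quadModule hreg h hI hle
  refine ⟨quadModule x y I, finColength_quadModule hk, modIntClosed_quadModule hI hM,
    ⟨(Submodule.ne_bot_iff _).2 ⟨_, koszul_mem_quadModule x y I 0 1, fun h0 => ?_⟩,
      fun hD => ?_⟩, hM⟩
  · refine ne_zero_of_maximalIdeal_eq hreg (maximalIdeal_eq_span_swap h) ?_
    simpa [koszul] using congrFun h0 1
  · obtain ⟨h4, h5⟩ := exists_factorization_of_decomposableSub hreg h hI hIp hle hD
    exact hfac h4 h5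

end Existence

section Pencil

variable {R : Type*} [CommRing R]

/-- The action of the matrix `x • 1 + l • C`. -/
def pencil (x l : R) (C : Matrix (Fin 3) (Fin 3) R) (v : Fin 3 → R) : Fin 3 → R :=
  x • v + l • C.mulVec v

lemma pencil_apply (x l : R) (C : Matrix (Fin 3) (Fin 3) R) (v : Fin 3 → R) (i : Fin 3) :
    pencil x l C v i = x * v i + l * (C i 0 * v 0 + C i 1 * v 1 + C i 2 * v 2) := by
  simp [pencil, Matrix.mulVec, dotProduct, Fin.sum_univ_three]

/-- The determinant of `x • 1 + l • C`. -/
def pencilDet (x l : R) (C : Matrix (Fin 3) (Fin 3) R) : R :=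
  x ^ 3 + x ^ 2 * l * C.trace + x * l ^ 2 * C.adjugate.trace + l ^ 3 * C.det

lemma tripleDet_pencil (x l : R) (C : Matrix (Fin 3) (Fin 3) R) (u v w : Fin 3 → R) :
    tripleDet (pencil x l C u) (pencil x l C v) (pencil x l C w) =
      pencilDet x l C * tripleDet u v w := by
  simp only [tripleDet, pencil_apply, pencilDet, Matrix.det_fin_three, Matrix.trace_fin_three,
    Matrix.adjugate_fin_three, Matrix.of_apply, Matrix.cons_val]
  ring

lemma pencil_shift (x l h : R) (C : Matrix (Fin 3) (Fin 3) R) (v : Fin 3 → R) :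
    pencil (x + h * l) l (C - h • 1) v = pencil x l C v := by
  ext i
  fin_cases i <;> simp [pencil_apply] <;> ring

lemma det_shift (h : R) (C : Matrix (Fin 3) (Fin 3) R) :
    (C - h • 1).det = C.det - h * C.adjugate.trace + h ^ 2 * C.trace - h ^ 3 := by
  simp [Matrix.det_fin_three, Matrix.trace_fin_three, Matrix.adjugate_fin_three]
  ring

lemma adjugate_trace_shift (h : R) (C : Matrix (Fin 3) (Fin 3) R) :
    (C - h • 1).adjugate.trace = C.adjugate.trace - h * (2 * C.trace - 3 * h) := by
  simp [Matrix.trace_fin_three, Matrix.adjugate_fin_three]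
  ring

lemma exists_coeff_tripleDet (X Y : Fin 3 → Fin 3 → R) : ∃ p₀ p₁ p₂ p₃ : R, ∀ a b : R,
    tripleDet (a • X 0 + b • Y 0) (a • X 1 + b • Y 1) (a • X 2 + b • Y 2) =
      p₃ * a ^ 3 + p₂ * (a ^ 2 * b) + p₁ * (a * b ^ 2) + p₀ * b ^ 3 := by
  refine ⟨tripleDet (Y 0) (Y 1) (Y 2),
    tripleDet (X 0) (Y 1) (Y 2) + tripleDet (Y 0) (X 1) (Y 2) + tripleDet (Y 0) (Y 1) (X 2),
    tripleDet (X 0) (X 1) (Y 2) + tripleDet (X 0) (Y 1) (X 2) + tripleDet (Y 0) (X 1) (X 2),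
    tripleDet (X 0) (X 1) (X 2), fun a b => ?_⟩
  simp only [tripleDet, Pi.add_apply, Pi.smul_apply, smul_eq_mul]
  ring

variable [IsLocalRing R]

lemma coeff_mem_of_forall_cubic_mem [Infinite (ResidueField R)] {p₀ p₁ p₂ p₃ : R}
    (h : ∀ a : R, p₃ * a ^ 3 + p₂ * a ^ 2 + p₁ * a + p₀ ∈ maximalIdeal R) :
    p₀ ∈ maximalIdeal R ∧ p₁ ∈ maximalIdeal R ∧ p₂ ∈ maximalIdeal R ∧ p₃ ∈ maximalIdeal R := by
  let P : Polynomial (ResidueField R) := .C (residue R p₃) * .X ^ 3 + .C (residue R p₂) * .X ^ 2 +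
    .C (residue R p₁) * .X + .C (residue R p₀)
  have hP : P = 0 := by
    refine Polynomial.funext fun a => ?_
    obtain ⟨a, rfl⟩ := residue_surjective a
    have h1 := (residue_eq_zero_iff _).2 (h a)
    simpa [P] using h1
  simp only [← residue_eq_zero_iff]
  refine ⟨?_, ?_, ?_, ?_⟩
  · simpa [P] using congrArg (fun p => p.coeff 0) hP
  · simpa [P, Polynomial.coeff_X, Polynomial.coeff_C] using congrArg (fun p => p.coeff 1) hP
  · simpa [P, Polynomial.coeff_X, Polynomial.coeff_C] using congrArg (fun p => p.coeff 2) hP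
  · simpa [P, Polynomial.coeff_X, Polynomial.coeff_C] using congrArg (fun p => p.coeff 3) hP

/-- `x`, `l` generate the maximal ideal and the image of `x • 1 + l • C` lies in `M`. -/
structure HasPencil (M : Submodule R (Fin 3 → R)) (x l : R) (C : Matrix (Fin 3) (Fin 3) R) :
    Prop where
  span_eq : maximalIdeal R = Ideal.span {x, l}
  mem : ∀ v, pencil x l C v ∈ M

lemma HasPencil.shift {M : Submodule R (Fin 3 → R)} {x l : R} {C : Matrix (Fin 3) (Fin 3) R}
    (hP : HasPencil M x l C) (h : R) : HasPencil M (x + h * l) l (C - h • 1) :=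
  ⟨maximalIdeal_eq_span_add_mul hP.span_eq h, fun v => pencil_shift x l h C v ▸ hP.mem v⟩

lemma HasPencil.pencilDet_mem {M : Submodule R (Fin 3 → R)} {x l : R}
    {C : Matrix (Fin 3) (Fin 3) R} (hP : HasPencil M x l C) : pencilDet x l C ∈ maxMinors M := by
  have h := tripleDet_mem_maxMinors (hP.mem (Pi.single 0 1)) (hP.mem (Pi.single 1 1))
    (hP.mem (Pi.single 2 1))
  rw [tripleDet_pencil] at h
  simpa [tripleDet] using h

lemma exists_hasPencil (hreg : IsTwoDimRegularLocal R) [Infinite (ResidueField R)]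
    {M : Submodule R (Fin 3 → R)} (hM : ∀ v ∈ M, ∀ i, v i ∈ maximalIdeal R)
    (h4 : ¬ maxMinors M ≤ maximalIdeal R ^ 4) : ∃ x l C, HasPencil M x l C := by
  obtain ⟨x, y, h⟩ := hreg.2.2
  have hx := left_mem_maximalIdeal h
  have hy := right_mem_maximalIdeal h
  have h5 : ∃ w : Fin 3 → Fin 3 → R, (∀ j, w j ∈ M) ∧
      tripleDet (w 0) (w 1) (w 2) ∉ maximalIdeal R ^ 4 := by
    by_contra! h6
    rw [maxMinors_le_iff] at h4
    refine h4 fun u hu v hv w hw => h6 ![u, v, w] fun j => ?_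
    fin_cases j <;> assumption
  obtain ⟨w, hw, hwd⟩ := h5
  have h6 : ∀ j i, ∃ p : R × R, w j i = x * p.1 + y * p.2 := fun j i => by
    have h7 := hM _ (hw j) i
    rw [h] at h7
    obtain ⟨a, b, e⟩ := Ideal.mem_span_pair.1 h7
    exact ⟨(a, b), by rw [← e]; ring⟩
  choose p hp using h6
  let X : Fin 3 → Fin 3 → R := fun j i => (p j i).1
  let Y : Fin 3 → Fin 3 → R := fun j i => (p j i).2
  have hwXY : ∀ j, w j = x • X j + y • Y j := fun j => funext (hp j)
  obtain ⟨p₀, p₁, p₂, p₃, hd⟩ := exists_coeff_tripleDet X Y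
  have h7 : ∃ a : R, IsUnit (tripleDet (a • X 0 + (1 : R) • Y 0) (a • X 1 + (1 : R) • Y 1)
      (a • X 2 + (1 : R) • Y 2)) := by
    by_contra! h8
    obtain ⟨h0, h1, h2, h3⟩ := coeff_mem_of_forall_cubic_mem (p₀ := p₀) (p₁ := p₁) (p₂ := p₂)
      (p₃ := p₃) fun a => by
        have h9 : _ ∈ maximalIdeal R := h8 a
        rw [hd] at h9
        simpa using h9
    apply hwd
    rw [hwXY, hwXY, hwXY, hd]
    have hxy (i j : ℕ) (hij : i + j = 3) : x ^ i * y ^ j ∈ maximalIdeal R ^ 3 := by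
      rw [← hij, pow_add]
      exact Ideal.mul_mem_mul (Ideal.pow_mem_pow hx i) (Ideal.pow_mem_pow hy j)
    have h30 := hxy 3 0 rfl
    have h21 := hxy 2 1 rfl
    have h12 := hxy 1 2 rfl
    have h03 := hxy 0 3 rfl
    simp only [pow_zero, pow_one, mul_one, one_mul] at h30 h21 h12 h03
    rw [pow_succ']
    exact add_mem (add_mem (add_mem (Ideal.mul_mem_mul h3 h30) (Ideal.mul_mem_mul h2 h21))
      (Ideal.mul_mem_mul h1 h12)) (Ideal.mul_mem_mul h0 h03)
  obtain ⟨a, ha⟩ := h7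
  let D : Matrix (Fin 3) (Fin 3) R := Matrix.of fun i j => a * X j i + Y j i
  let X' : Matrix (Fin 3) (Fin 3) R := Matrix.of fun i j => X j i
  have hD : IsUnit D.det := by
    convert ha using 1
    simp only [D, Matrix.det_fin_three, Matrix.of_apply, tripleDet, Pi.add_apply, Pi.smul_apply,
      smul_eq_mul]
    ring
  refine ⟨y, x + -a * y, X' * D⁻¹, ?_, fun v => ?_⟩
  · rw [maximalIdeal_eq_span_add_mul h (-a), Set.pair_comm]
  · have h8 : pencil y (x + -a * y) (X' * D⁻¹) v =
        ∑ j, (D⁻¹.mulVec v) j • w j := by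
      have h9 : v = D.mulVec (D⁻¹.mulVec v) := by
        rw [Matrix.mulVec_mulVec, Matrix.mul_nonsing_inv D hD, Matrix.one_mulVec]
      have h10 : pencil y (x + -a * y) (X' * D⁻¹) v = y • D.mulVec (D⁻¹.mulVec v) +
          (x + -a * y) • X'.mulVec (D⁻¹.mulVec v) := by
        rw [← h9, pencil, Matrix.mulVec_mulVec]
      rw [h10]
      generalize D⁻¹.mulVec v = u
      ext i
      simp only [hwXY, D, X', Matrix.mulVec, dotProduct, Fin.sum_univ_three, Matrix.of_apply,
        Pi.add_apply, Pi.smul_apply, smul_eq_mul]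
      ring
    rw [h8]
    exact sum_mem fun j _ => M.smul_mem _ (hw j)

end Pencil

section IndecomposableModel

variable {R : Type*} [CommRing R] [IsLocalRing R]

/-- `M` is an integrally closed submodule of finite colength in `R ^ 3` without proper direct
summands over a two-dimensional regular local ring, and its ideal of maximal minors is integrally
closed. -/
structure IsModel (M : Submodule R (Fin 3 → R)) : Prop where
  reg : IsTwoDimRegularLocal R
  idealIntClosed : IdealIntClosed (maxMinors M)
  finColength : FinColength M
  modIntClosed : ModIntClosed M
  not_decomposable : ¬ DecomposableSub M

variable {M : Submodule R (Fin 3 → R)}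

namespace IsModel

lemma smul_mem_of_forall_tripleDet (hM : IsModel M) {m : R} {f : Fin 3 → R}
    (h : ∀ u ∈ M, ∀ w ∈ M, m * tripleDet f u w ∈ maxMinors M) : m • f ∈ M := by
  refine hM.modIntClosed _ (integralOverMod_of_forall_tripleDet fun u hu w hw => ?_)
  convert h u hu w hw using 1
  simp only [tripleDet, Pi.smul_apply, smul_eq_mul]
  ring

lemma mul_tripleDet_mem (_ : IsModel M) {m : R} {f u w : Fin 3 → R} (hf : m • f ∈ M) (hu : u ∈ M)
    (hw : w ∈ M) : m * tripleDet f u w ∈ maxMinors M := by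
  convert tripleDet_mem_maxMinors hf hu hw using 1
  simp only [tripleDet, Pi.smul_apply, smul_eq_mul]
  ring

variable [IsDomain R]

lemma apply_mem_of_forall_apply_smul_mem (hM : IsModel M) {f : Fin 3 → R} {i : Fin 3}
    (h : ∀ v ∈ M, v i • f ∈ M) : f i ∈ maximalIdeal R := by
  by_contra hf
  obtain ⟨a, ha⟩ := (isUnit_of_notMem_maximalIdeal hf).exists_left_inv
  refine hM.not_decomposable (decomposableSub_of_splitting hM.reg hM.finColength (f := f)
    (c := a • LinearMap.proj i) (by simpa using ha) fun v hv => ?_)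
  simpa [mul_smul] using M.smul_mem a (h v hv)

lemma apply_mem (hM : IsModel M) {v : Fin 3 → R} (hv : v ∈ M) (i : Fin 3) :
    v i ∈ maximalIdeal R :=
  hM.apply_mem_of_forall_apply_smul_mem fun _ _ => M.smul_mem _ hv

lemma maxMinors_le (hM : IsModel M) : maxMinors M ≤ maximalIdeal R ^ 3 :=
  maxMinors_le_iff.2 fun _ hu _ hv _ hw =>
    tripleDet_mem_cube (hM.apply_mem hu) (hM.apply_mem hv) (hM.apply_mem hw)

lemma apply_mem_of_smul_mem (hM : IsModel M) {f : Fin 3 → R}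
    (h : ∀ m ∈ maximalIdeal R, m • f ∈ M) (i : Fin 3) : f i ∈ maximalIdeal R :=
  hM.apply_mem_of_forall_apply_smul_mem fun _ hv => h _ (hM.apply_mem hv i)

variable {x l : R} {C : Matrix (Fin 3) (Fin 3) R}

lemma mul_mem_of_mul_mem (hM : IsModel M) (hP : HasPencil M x l C) {z : R}
    (hz : z ∈ maximalIdeal R ^ 2) (hlz : l * z ∈ maxMinors M) {m : R}
    (hm : m ∈ maximalIdeal R) : m * z ∈ maxMinors M := by
  refine hM.idealIntClosed.mem_of_forall_mul_mem hM.reg 3 fun p hp => ?_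
  obtain ⟨m', hm', c, rfl⟩ :=
    exists_of_mem_pow_succ (maximalIdeal_eq_span_swap hP.span_eq) (k := 2) hp
  have hx := left_mem_maximalIdeal hP.span_eq
  have hl := right_mem_maximalIdeal hP.span_eq
  have e : m * z * (l * m' + c * x ^ 3) =
      l * z * (m * (m' - c * (x ^ 2 * C.trace + x * l * C.adjugate.trace + l ^ 2 * C.det))) +
        pencilDet x l C * (m * (c * z)) := by
    rw [pencilDet]
    ring
  rw [e]
  refine add_mem (Ideal.mul_mem_mul hlz ?_) (Ideal.mul_mem_mul hP.pencilDet_mem ?_)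
  · rw [pow_succ']
    refine Ideal.mul_mem_mul hm (sub_mem hm' (Ideal.mul_mem_left _ _ (add_mem (add_mem ?_ ?_) ?_)))
    · exact Ideal.mul_mem_right _ _ (Ideal.pow_mem_pow hx 2)
    · rw [pow_two]
      exact Ideal.mul_mem_right _ _ (Ideal.mul_mem_mul hx hl)
    · exact Ideal.mul_mem_right _ _ (Ideal.pow_mem_pow hl 2)
  · rw [pow_succ']
    exact Ideal.mul_mem_mul hm (Ideal.mul_mem_left _ _ hz)

lemma apply_mem_of_right_smul_mem (hM : IsModel M) (hP : HasPencil M x l C) {f : Fin 3 → R}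
    (hf : l • f ∈ M) : ∀ i, f i ∈ maximalIdeal R :=
  hM.apply_mem_of_smul_mem fun _ hm => hM.smul_mem_of_forall_tripleDet fun _ hu _ hw =>
    hM.mul_mem_of_mul_mem hP (tripleDet_mem_sq (hM.apply_mem hu) (hM.apply_mem hw))
      (hM.mul_tripleDet_mem hf hu hw) hm

lemma exists_eq_pencil_add (hM : IsModel M) (hP : HasPencil M x l C) {v : Fin 3 → R}
    (hv : v ∈ M) : ∃ a r, v = pencil x l C a + r ∧ ∀ i, r i ∈ maximalIdeal R ^ 2 := by
  have h : ∀ i, ∃ p : R × R, v i = x * p.1 + l * p.2 := fun i => by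
    have h7 := hM.apply_mem hv i
    rw [hP.span_eq] at h7
    obtain ⟨a, b, e⟩ := Ideal.mem_span_pair.1 h7
    exact ⟨(a, b), by rw [← e]; ring⟩
  choose p hp using h
  let a : Fin 3 → R := fun i => (p i).1
  let f : Fin 3 → R := (fun i => (p i).2) - C.mulVec a
  have e : v - pencil x l C a = l • f := by
    ext i
    simp only [pencil, Pi.sub_apply, Pi.add_apply, Pi.smul_apply, smul_eq_mul, hp, a, f]
    ring
  refine ⟨a, l • f, by rw [← e]; abel, fun i => ?_⟩
  rw [pow_two]
  exact Ideal.mul_mem_mul (right_mem_maximalIdeal hP.span_eq)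
    (hM.apply_mem_of_right_smul_mem hP (e ▸ sub_mem hv (hP.mem a)) i)

lemma exists_eq_pencilDet (hM : IsModel M) (hP : HasPencil M x l C) {z : R}
    (hz : z ∈ maxMinors M) : ∃ r, ∃ t ∈ maximalIdeal R ^ 4, z = r * pencilDet x l C + t := by
  have key : maxMinors M ≤ Ideal.span {pencilDet x l C} ⊔ maximalIdeal R ^ 4 := by
    refine maxMinors_le_iff.2 fun u hu v hv w hw => ?_
    obtain ⟨a, p, rfl, hp⟩ := hM.exists_eq_pencil_add hP hu
    obtain ⟨b, q, rfl, hq⟩ := hM.exists_eq_pencil_add hP hv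
    obtain ⟨c, r, rfl, hr⟩ := hM.exists_eq_pencil_add hP hw
    have ha := hM.apply_mem (hP.mem a)
    have hb := hM.apply_mem (hP.mem b)
    have e : tripleDet (pencil x l C a + p) (pencil x l C b + q) (pencil x l C c + r) =
        pencilDet x l C * tripleDet a b c + (tripleDet (pencil x l C a) (pencil x l C b) r +
          (tripleDet (pencil x l C a) q (pencil x l C c + r) +
          tripleDet p (pencil x l C b + q) (pencil x l C c + r))) := by
      rw [← tripleDet_pencil]
      simp only [tripleDet, Pi.add_apply]
      ring
    rw [e]
    refine Submodule.add_mem_sup (Ideal.mul_mem_right _ _ (Ideal.mem_span_singleton_self _))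
      (add_mem ?_ (add_mem ?_ ?_))
    · convert tripleDet_mem_mul ha hb hr using 1
      ring
    · convert tripleDet_mem_mul ha hq (hM.apply_mem hw) using 1
      ring
    · convert tripleDet_mem_mul hp (hM.apply_mem hv) (hM.apply_mem hw) using 1
      ring
  obtain ⟨y, hy, t, ht, rfl⟩ := Submodule.mem_sup.1 (key hz)
  obtain ⟨r, rfl⟩ := Ideal.mem_span_singleton'.1 hy
  exact ⟨r, t, ht, rfl⟩

end IsModel

end IndecomposableModel

section FactoredModel

variable {R : Type*} [CommRing R] [IsLocalRing R] {M : Submodule R (Fin 3 → R)}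

lemma HasPencil.mul_adjugate_mulVec_mem {x l : R} {C : Matrix (Fin 3) (Fin 3) R}
    (hP : HasPencil M x l C) (hd : C.det ∈ maxMinors M) {v : Fin 3 → R} (hv : v ∈ M) (i : Fin 3) :
    (x ^ 2 + x * l * C.trace + l ^ 2 * C.adjugate.trace) * C.adjugate.mulVec v i ∈
      maxMinors M := by
  have h0 := hP.mem (Pi.single 0 1)
  have h1 := hP.mem (Pi.single 1 1)
  have h2 := hP.mem (Pi.single 2 1)
  have e : (x ^ 2 + x * l * C.trace + l ^ 2 * C.adjugate.trace) * C.adjugate.mulVec v i =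
      C.adjugate i 0 * tripleDet v (pencil x l C (Pi.single 1 1)) (pencil x l C (Pi.single 2 1)) +
      C.adjugate i 1 * tripleDet (pencil x l C (Pi.single 0 1)) v (pencil x l C (Pi.single 2 1)) +
      C.adjugate i 2 * tripleDet (pencil x l C (Pi.single 0 1)) (pencil x l C (Pi.single 1 1)) v +
      C.det * (x * l * v i - l ^ 2 * (C.mulVec v i - C.trace * v i)) := by
    simp only [tripleDet, pencil_apply, Matrix.mulVec, dotProduct, Fin.sum_univ_three,
      Matrix.det_fin_three, Matrix.trace_fin_three, Matrix.adjugate_fin_three, Matrix.of_apply,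
      Matrix.cons_val]
    fin_cases i <;> simp <;> ring
  rw [e]
  exact add_mem (add_mem (add_mem (Ideal.mul_mem_left _ _ (tripleDet_mem_maxMinors hv h1 h2))
    (Ideal.mul_mem_left _ _ (tripleDet_mem_maxMinors h0 hv h2)))
    (Ideal.mul_mem_left _ _ (tripleDet_mem_maxMinors h0 h1 hv))) (Ideal.mul_mem_right _ _ hd)

lemma HasPencil.exists_det_mem_pow {x l : R} {C : Matrix (Fin 3) (Fin 3) R}
    (hP : HasPencil M x l C) (ht : C.adjugate.trace ∉ maximalIdeal R)
    (hd : C.det ∈ maximalIdeal R) (N : ℕ) : ∃ x C, HasPencil M x l C ∧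
      C.adjugate.trace ∉ maximalIdeal R ∧ C.det ∈ maximalIdeal R ^ (N + 1) := by
  induction N with
  | zero => exact ⟨x, C, hP, ht, by simpa using hd⟩
  | succ N ih =>
    obtain ⟨x, C, hP, ht, hd⟩ := ih
    obtain ⟨e, he⟩ := (isUnit_of_notMem_maximalIdeal ht).exists_left_inv
    have h1 : C.det ∈ maximalIdeal R := Ideal.pow_le_self (by lia) hd
    refine ⟨_, _, hP.shift (e * C.det), ?_, ?_⟩
    · rw [adjugate_trace_shift]
      intro h
      exact ht ((Submodule.sub_mem_iff_left _
        (Ideal.mul_mem_right _ _ (Ideal.mul_mem_left _ _ h1))).1 h)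
    · rw [det_shift]
      have e1 : C.det - e * C.det * C.adjugate.trace + (e * C.det) ^ 2 * C.trace -
          (e * C.det) ^ 3 = C.det * C.det * (e ^ 2 * C.trace - e ^ 3 * C.det) +
          C.det * (1 - e * C.adjugate.trace) := by ring
      rw [e1, he, sub_self, mul_zero, add_zero, pow_succ]
      exact Ideal.mul_mem_right _ _ (Ideal.mul_mem_mul hd h1)

namespace IsModel

variable [IsDomain R] {x l : R} {C : Matrix (Fin 3) (Fin 3) R}

lemma adjugate_trace_mem (hM : IsModel M) (hP : HasPencil M x l C) (hd : C.det ∈ maxMinors M)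
    (hdM : ∀ v, C.det • v ∈ M) : C.adjugate.trace ∈ maximalIdeal R := by
  by_contra ht
  obtain ⟨i, hi⟩ : ∃ i, C.adjugate i i ∉ maximalIdeal R := by
    by_contra! h
    exact ht (sum_mem fun i _ => h i)
  have hd1 : C.det ∈ maximalIdeal R := Ideal.pow_le_self (by lia) (hM.maxMinors_le hd)
  let f : Fin 3 → R := fun j => C.adjugate j i
  have hf : x • f ∈ M := by
    have e : x • f = pencil x l C f - l • C.det • Pi.single i 1 := by
      have e1 : C.mulVec f = C.det • Pi.single i 1 := by
        ext j
        have h2 := congrFun (congrFun C.mul_adjugate j) i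
        rw [Matrix.mul_apply] at h2
        rw [Matrix.mulVec, dotProduct, h2]
        simp [Matrix.one_apply, Pi.single_apply]
      rw [pencil, e1]
      abel
    rw [e]
    exact sub_mem (hP.mem f) (M.smul_mem _ (hdM _))
  have hB : C.adjugate.mulVec f i ∉ maximalIdeal R := by
    have e : C.adjugate.mulVec f i =
        C.adjugate.trace * C.adjugate i i + C.det * (C i i - C.trace) := by
      simp only [f, Matrix.mulVec, dotProduct, Fin.sum_univ_three, Matrix.det_fin_three,
        Matrix.trace_fin_three, Matrix.adjugate_fin_three, Matrix.of_apply, Matrix.cons_val]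
      fin_cases i <;> simp <;> ring
    rw [e]
    intro h
    refine ((maximalIdeal.isMaximal R).isPrime.mem_or_mem
      ((Ideal.add_mem_iff_left _ (Ideal.mul_mem_right _ _ hd1)).1 h)).elim ht hi
  obtain ⟨b, hb⟩ := (isUnit_of_notMem_maximalIdeal hB).exists_left_inv
  obtain ⟨e, he⟩ := (isUnit_of_notMem_maximalIdeal ht).exists_left_inv
  refine hM.not_decomposable (decomposableSub_of_splitting hM.reg hM.finColength (f := f)
    (c := b • LinearMap.proj i ∘ₗ C.adjugate.mulVecLin) (by simpa using hb) fun v hv => ?_)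
  have key : C.adjugate.mulVec v i • f ∈ M := by
    refine hM.smul_mem_of_forall_tripleDet fun u hu w hw =>
      hM.idealIntClosed.mem_of_forall_mul_mem hM.reg 2 fun m hm => ?_
    obtain ⟨m', hm', c, rfl⟩ := exists_of_mem_pow_succ hP.span_eq (k := 1) hm
    rw [pow_one] at hm'
    have hx := left_mem_maximalIdeal hP.span_eq
    have hz := tripleDet_mem_sq (u := f) (hM.apply_mem hu) (hM.apply_mem hw)
    have hxz := hM.mul_tripleDet_mem hf hu hw
    have hδ := hP.mul_adjugate_mulVec_mem hd hv i
    have ha : C.adjugate.mulVec v i ∈ maximalIdeal R := by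
      rw [Matrix.mulVec, dotProduct]
      exact sum_mem fun k _ => Ideal.mul_mem_left _ _ (hM.apply_mem hv k)
    generalize C.adjugate.mulVec v i = a at *
    generalize tripleDet f u w = z at *
    have e1 : a * z * (x * m' + c * l ^ (1 + 1)) =
        x * z * (a * (m' - c * e * (x + l * C.trace))) +
        (x ^ 2 + x * l * C.trace + l ^ 2 * C.adjugate.trace) * a * (c * e * z) := by
      linear_combination (-(a * z * c * l ^ 2)) * he
    rw [e1]
    refine add_mem (Ideal.mul_mem_mul hxz ?_) (Ideal.mul_mem_mul hδ (Ideal.mul_mem_left _ _ hz))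
    rw [pow_two]
    exact Ideal.mul_mem_mul ha (sub_mem hm' (Ideal.mul_mem_left _ _ (add_mem hx
      (Ideal.mul_mem_right _ _ (right_mem_maximalIdeal hP.span_eq)))))
  simpa [mul_smul] using M.smul_mem b key

variable {J K : Ideal R}

lemma notMem_of_mul_eq (hM : IsModel M) (hP : HasPencil M x l C) {j κ r t : R}
    (hj : j ∈ maximalIdeal R) (hj2 : j ∉ maximalIdeal R ^ 2) (hκ : κ ∉ maximalIdeal R ^ 3)
    (ht : t ∈ maximalIdeal R ^ 4) (e : j * κ = r * pencilDet x l C + t) :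
    r ∉ maximalIdeal R := by
  refine fun hr => hκ (mem_pow_of_mul_mem hM.reg hj hj2 ?_)
  rw [e]
  refine add_mem ?_ ht
  rw [pow_succ']
  exact Ideal.mul_mem_mul hr (hM.maxMinors_le hP.pencilDet_mem)

lemma exists_hasPencil_of_mem (hM : IsModel M) (hI : maxMinors M = J * K)
    (hJ : J ≤ maximalIdeal R) (hJ2 : ¬ J ≤ maximalIdeal R ^ 2) (hK : K ≤ maximalIdeal R ^ 2)
    (hK3 : ¬ K ≤ maximalIdeal R ^ 3) (hP : HasPencil M x l C) :
    ∃ x l C, HasPencil M x l C ∧ x ∈ J := by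
  obtain ⟨j, hj, hj2⟩ := SetLike.not_le_iff_exists.1 hJ2
  obtain ⟨κ, hκ, hκ3⟩ := SetLike.not_le_iff_exists.1 hK3
  obtain ⟨r, t, ht, e⟩ := hM.exists_eq_pencilDet hP (hI ▸ Ideal.mul_mem_mul hj hκ)
  have hr := hM.notMem_of_mul_eq hP (hJ hj) hj2 hκ3 ht e
  have h1 := hJ hj
  rw [hP.span_eq] at h1
  obtain ⟨α, β, rfl⟩ := Ideal.mem_span_pair.1 h1
  have hα : α ∉ maximalIdeal R := by
    refine fun hα => hr (mem_maximalIdeal_of_mul_pow_eq hM.reg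
      (maximalIdeal_eq_span_swap hP.span_eq) (k := 3) (t := α * (x * κ) - t)
      (s := β * κ - r * (x ^ 2 * C.trace + x * l * C.adjugate.trace + l ^ 2 * C.det))
      (sub_mem ?_ ht) ?_)
    · rw [pow_succ', pow_succ']
      exact Ideal.mul_mem_mul hα (Ideal.mul_mem_mul (left_mem_maximalIdeal hP.span_eq) (hK hκ))
    · rw [pencilDet] at e
      linear_combination -e
  obtain ⟨a, ha⟩ := (isUnit_of_notMem_maximalIdeal hα).exists_left_inv
  refine ⟨_, l, _, hP.shift (a * β), ?_⟩
  convert J.mul_mem_left a hj using 1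
  linear_combination (-x) * ha

lemma adjugate_trace_notMem_and_det_mem (hM : IsModel M) (hI : maxMinors M = J * K)
    (hJ : J ≤ maximalIdeal R) (hK3 : ¬ K ≤ maximalIdeal R ^ 3)
    (hJK : maximalIdeal R ^ 2 = maximalIdeal R * J + K) (hP : HasPencil M x l C) (hx : x ∈ J) :
    C.adjugate.trace ∉ maximalIdeal R ∧ C.det ∈ maximalIdeal R := by
  have hxm := left_mem_maximalIdeal hP.span_eq
  have hlm := right_mem_maximalIdeal hP.span_eq
  obtain ⟨κ₀, hκ₀, hκ₃⟩ := SetLike.not_le_iff_exists.1 hK3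
  have hx2 : x ∉ maximalIdeal R ^ 2 := fun h => by
    have h1 := mem_pow_of_left_mul_mem hM.reg hP.span_eq (z := 1) (k := 1) (by simpa using h)
    simp at h1
  obtain ⟨r, t, ht, e⟩ := hM.exists_eq_pencilDet hP (hI ▸ Ideal.mul_mem_mul hx hκ₀)
  have hr := hM.notMem_of_mul_eq hP hxm hx2 hκ₃ ht e
  have hcoeff (a b : R) (hab : a * x + b * l ∈ J) : b ∈ maximalIdeal R := by
    obtain ⟨r', t', ht', e'⟩ := hM.exists_eq_pencilDet hP (hI ▸ Ideal.mul_mem_mul hab hκ₀)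
    have h1 : ((r * a - r') * x + r * b * l) * κ₀ ∈ maximalIdeal R ^ 4 := by
      have h2 := sub_mem (Ideal.mul_mem_left _ r ht') (Ideal.mul_mem_left _ r' ht)
      convert h2 using 1
      linear_combination r * e' - r' * e
    have h3 : (r * a - r') * x + r * b * l ∈ maximalIdeal R ^ 2 := by
      by_contra h4
      exact hκ₃ (mem_pow_of_mul_mem hM.reg (add_mem (Ideal.mul_mem_left _ _ hxm)
        (Ideal.mul_mem_left _ _ hlm)) h4 h1)
    refine ((maximalIdeal.isMaximal R).isPrime.mem_or_mem (mem_maximalIdeal_of_mul_pow_eq hM.reg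
      hP.span_eq (c := r * b) (s := r' - r * a) (k := 1) h3 ?_)).resolve_left hr
    ring
  have hl2 : l ^ 2 ∈ maximalIdeal R * J + K := hJK ▸ Ideal.pow_mem_pow hlm 2
  obtain ⟨p, hp, κ, hκ, e2⟩ := Submodule.mem_sup.1 hl2
  obtain ⟨p₁, hp₁, p₂, hp₂, rfl⟩ := (mem_maximalIdeal_mul_iff hP.span_eq).1 hp
  have h1 := hJ hp₂
  rw [hP.span_eq] at h1
  obtain ⟨a, b, rfl⟩ := Ideal.mem_span_pair.1 h1
  have hb := hcoeff a b hp₂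
  obtain ⟨q, t', ht', e'⟩ := hM.exists_eq_pencilDet hP (hI ▸ Ideal.mul_mem_mul hx hκ)
  rw [pencilDet] at e'
  let s : R := κ - q * (x ^ 2 + x * l * C.trace + l ^ 2 * C.adjugate.trace)
  have hqd : q * C.det ∈ maximalIdeal R := by
    refine mem_maximalIdeal_of_mul_pow_eq hM.reg hP.span_eq (k := 3) (s := s) (neg_mem ht') ?_
    linear_combination -e'
  have hs : s ∈ maximalIdeal R ^ 3 := by
    refine mem_pow_of_left_mul_mem hM.reg hP.span_eq ?_
    have h2 : q * C.det * l ^ 3 + t' ∈ maximalIdeal R ^ (3 + 1) := by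
      refine add_mem ?_ ht'
      rw [pow_succ']
      exact Ideal.mul_mem_mul hqd (Ideal.pow_mem_pow hlm 3)
    convert h2 using 1
    linear_combination e'
  have h3 : 1 - b - q * C.adjugate.trace ∈ maximalIdeal R := by
    refine mem_maximalIdeal_of_mul_pow_eq hM.reg hP.span_eq (k := 2)
      (s := p₁ + l * a + q * (x + l * C.trace)) hs ?_
    linear_combination -e2
  have h4 : q * C.adjugate.trace ∉ maximalIdeal R := fun h => by
    refine (Ideal.ne_top_iff_one _).1 (maximalIdeal.isMaximal R).ne_top ?_
    convert add_mem (add_mem h3 hb) h using 1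
    ring
  exact ⟨fun h => h4 (Ideal.mul_mem_left _ _ h),
    ((maximalIdeal.isMaximal R).isPrime.mem_or_mem hqd).resolve_left
      fun h => h4 (Ideal.mul_mem_right _ _ h)⟩

lemma not_factorization [Infinite (ResidueField R)] (hM : IsModel M)
    (hIp : IsMPrimary (maxMinors M)) (h4 : ¬ maxMinors M ≤ maximalIdeal R ^ 4)
    (hI : maxMinors M = J * K) (hJ : ordEQ J 1) (hK : ordEQ K 2) :
    maximalIdeal R ^ 2 ≠ maximalIdeal R * J + K := by
  intro hJK
  have := hM.reg.1
  have hJ1 : J ≤ maximalIdeal R := by simpa using hJ.1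
  obtain ⟨y, l, C, hP⟩ := exists_hasPencil hM.reg (fun _ hv => hM.apply_mem hv) h4
  obtain ⟨x, l, C, hP, hx⟩ := hM.exists_hasPencil_of_mem hI hJ1 hJ.2 hK.1 hK.2 hP
  obtain ⟨ht, hd⟩ := hM.adjugate_trace_notMem_and_det_mem hI hJ1 hK.2 hJK hP hx
  obtain ⟨k, hk⟩ := hM.finColength.exists_pow_smul_mem
  obtain ⟨k', hk'⟩ := exists_pow_le_of_isMPrimary hIp
  obtain ⟨x, C, hP, ht, hd⟩ := hP.exists_det_mem_pow ht hd (k + k')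
  exact ht (hM.adjugate_trace_mem hP (hk' (Ideal.pow_le_pow_right (by lia) hd))
    (hk _ (Ideal.pow_le_pow_right (by lia) hd)))

end IsModel

end FactoredModel

/-- main theorem, rank-3 characterisation: an integrally closed `𝔪`-primary
ideal `I` of order `n` is `I(M)` for an indecomposable integrally closed module `M` of
rank `3` iff `n > 3`, or `n = 3` and there is no factorisation `I = JK` into `𝔪`-primary
integrally closed ideals `J, K` of orders `1, 2` with
(a) `λ(R/JK) = λ(R/J) + λ(R/K) + 2` and (b) `𝔪² = 𝔪J + K`. -/
theorem statement19 (R : Type*) [CommRing R] [IsLocalRing R]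
    (hreg : IsTwoDimRegularLocal R) [Infinite (IsLocalRing.ResidueField R)]
    (I : Ideal R) (hIc : IdealIntClosed I) (hIp : IsMPrimary I)
    (n : ℕ) (hord : ordEQ I n) :
    (∃ M : Submodule R (Fin 3 → R),
      FinColength M ∧ ModIntClosed M ∧ IndecomposableSub M ∧ maxMinors M = I) ↔
    (3 < n ∨ (n = 3 ∧
      ¬ ∃ J K : Ideal R,
        IdealIntClosed J ∧ IsMPrimary J ∧ ordEQ J 1 ∧
        IdealIntClosed K ∧ IsMPrimary K ∧ ordEQ K 2 ∧
        I = J * K ∧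
        modLength R (R ⧸ (J * K)) =
          modLength R (R ⧸ J) + modLength R (R ⧸ K) + ((2 : ℕ) : WithBot ℕ∞) ∧
        maximalIdeal R ^ 2 = maximalIdeal R * J + K)) := by
  have := isDomain_of_isTwoDimRegularLocal hreg
  constructor
  · rintro ⟨M, hM, hMc, hMi, rfl⟩
    have hmod : IsModel M := ⟨hreg, hIc, hM, hMc, hMi.2⟩
    have hn : 3 ≤ n := by
      by_contra! h
      exact hord.2 (hmod.maxMinors_le.trans (Ideal.pow_le_pow_right h))
    refine hn.lt_or_eq.imp_right fun h => ?_
    subst h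
    refine ⟨rfl, ?_⟩
    rintro ⟨J, K, -, -, hJ, -, -, hK, hJK, -, hsq⟩
    exact hmod.not_factorization hIp hord.2 hJK hJ hK hsq
  · intro h
    have hn : 3 ≤ n := by lia
    refine exists_indecomposableSub hreg hIc hIp (hord.1.trans (Ideal.pow_le_pow_right hn))
      fun h4 => ?_
    rcases h with h | ⟨-, h⟩
    · exact absurd (hord.1.trans (Ideal.pow_le_pow_right h)) h4
    · exact h
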